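/- arXiv:1706.06467 — 7 statements merged into one kernel-verified Lean document; each statement's English description precedes it below -/
import Mathlib

section
/- Let d ≥ 2 be an integer, δ > 0 a real number, and v ∈ ℤ^{d−1} an integer vector. Then the number of integer points in the translated Hilbert ball v + B_H(δ) ⊆ ℝ^{d−1} equals (⌊δ⌋+1)^d − ⌊δ⌋^d; in particular this number does not depend on v. -/
open MeasureTheory Pointwise

noncomputable section

/-- Hilbert ball of radius `δ` in `ℝ^n` (chart coordinates): the set of `y` with
`max(0, max_i y_i) - min(0, min_i y_i) ≤ δ`. -/
def hilbertBall (n : ℕ) (δ : ℝ) : Set (Fin n → ℝ) :=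
  {y | max 0 (⨆ i, y i) - min 0 (⨅ i, y i) ≤ δ}

/-- In homogeneous coordinates `(0, y)`, the Hilbert ball bounds all coordinate differences. -/
theorem mem_hilbertBall_iff {n : ℕ} [NeZero n] {δ : ℝ} (hδ : 0 ≤ δ) (y : Fin n → ℝ) :
    y ∈ hilbertBall n δ ↔
      (∀ i, y i ≤ δ) ∧ (∀ i, -y i ≤ δ) ∧ ∀ i j, y i - y j ≤ δ := by
  have hle : ∀ i, y i ≤ ⨆ i, y i := le_ciSup (Set.finite_range y).bddAbove
  have hge : ∀ i, ⨅ i, y i ≤ y i := ciInf_le (Set.finite_range y).bddBelow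
  obtain ⟨a, ha⟩ := exists_eq_ciSup_of_finite (f := y)
  obtain ⟨b, hb⟩ := exists_eq_ciInf_of_finite (f := y)
  rw [hilbertBall, Set.mem_ofPred_eq]
  constructor
  · intro h
    have h1 := le_max_left 0 (⨆ i, y i)
    have h2 := le_max_right 0 (⨆ i, y i)
    have h3 := min_le_left 0 (⨅ i, y i)
    have h4 := min_le_right 0 (⨅ i, y i)
    refine ⟨fun i => ?_, fun i => ?_, fun i j => ?_⟩
    · linarith [hle i]
    · linarith [hge i]
    · linarith [hle i, hge j]
  · rintro ⟨h1, h2, h3⟩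
    rw [← ha, ← hb]
    have := h1 a
    have := h2 b
    have := h3 a b
    rcases max_choice 0 (y a) with h | h <;> rcases min_choice 0 (y b) with h' | h' <;>
      rw [h, h'] <;> linarith

/-- The integer points of homogeneous coordinates with minimum `0` and maximum at most `m`. -/
def normalizedPoints (n : ℕ) (m : ℤ) : Finset (Fin (n + 1) → ℤ) :=
  (Fintype.piFinset fun _ => Finset.Icc 0 m) \ Fintype.piFinset fun _ => Finset.Icc 1 m

theorem mem_normalizedPoints {n : ℕ} {m : ℤ} {f : Fin (n + 1) → ℤ} :
    f ∈ normalizedPoints n m ↔ (∀ i, 0 ≤ f i ∧ f i ≤ m) ∧ ∃ k, f k = 0 := by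
  simp only [normalizedPoints, Finset.mem_sdiff, Fintype.mem_piFinset, Finset.mem_Icc, not_forall]
  refine and_congr_right fun h => exists_congr fun k => ?_
  have := h k
  omega

theorem card_normalizedPoints (n : ℕ) {m : ℤ} (hm : 0 ≤ m) :
    ((normalizedPoints n m).card : ℤ) = (m + 1) ^ (n + 1) - m ^ (n + 1) := by
  have hsub : (Fintype.piFinset fun _ : Fin (n + 1) => Finset.Icc 1 m) ⊆
      Fintype.piFinset fun _ => Finset.Icc 0 m :=
    Fintype.piFinset_subset _ _ fun _ => Finset.Icc_subset_Icc_left zero_le_one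
  rw [normalizedPoints, Finset.cast_card_sdiff hsub]
  simp [Fintype.card_piFinset, Int.toNat_of_nonneg hm,
    Int.toNat_of_nonneg (show 0 ≤ m + 1 by omega)]

/-- Dehomogenization followed by translation by `v`. -/
def translatedChart {n : ℕ} (v : Fin n → ℤ) (f : Fin (n + 1) → ℤ) : Fin n → ℤ :=
  fun i => v i + (f i.succ - f 0)

theorem injOn_translatedChart {n : ℕ} (m : ℤ) (v : Fin n → ℤ) :
    Set.InjOn (translatedChart v) (normalizedPoints n m) := by
  intro f hf g hg hfg
  rw [Finset.mem_coe, mem_normalizedPoints] at hf hg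
  obtain ⟨hf, k, hk⟩ := hf
  obtain ⟨hg, l, hl⟩ := hg
  have hdiff : ∀ i, f i - f 0 = g i - g 0 := by
    refine Fin.cases (by simp) fun i => ?_
    have := congrFun hfg i
    simp only [translatedChart] at this
    omega
  funext i
  have := hdiff i
  have := hdiff k
  have := hdiff l
  have := hg k
  have := hf l
  omega

theorem image_translatedChart {n : ℕ} [NeZero n] {δ : ℝ} (hδ : 0 ≤ δ) (v : Fin n → ℤ) :
    {w : Fin n → ℤ |
        (fun i => (w i : ℝ)) ∈ ((fun i => (v i : ℝ)) + ·) '' hilbertBall n δ} =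
      translatedChart v '' normalizedPoints n ⌊δ⌋ := by
  ext w
  have key : (fun i => (w i : ℝ)) ∈ ((fun i => (v i : ℝ)) + ·) '' hilbertBall n δ ↔
      (∀ i, w i - v i ≤ ⌊δ⌋) ∧ (∀ i, -(w i - v i) ≤ ⌊δ⌋) ∧
        ∀ i j, (w i - v i) - (w j - v j) ≤ ⌊δ⌋ := by
    rw [Set.image_add_left, Set.mem_preimage, mem_hilbertBall_iff hδ]
    simp only [Int.le_floor, Pi.add_apply, Pi.neg_apply]
    push_cast
    simp only [sub_eq_neg_add]
  rw [Set.mem_ofPred_eq, key]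
  constructor
  · rintro ⟨h1, h2, h3⟩
    have hm : 0 ≤ ⌊δ⌋ := Int.floor_nonneg.2 hδ
    let u : Fin (n + 1) → ℤ := Fin.cons 0 fun i => w i - v i
    have hu : ∀ i j, u i - u j ≤ ⌊δ⌋ := by
      refine Fin.cases (Fin.cases ?_ fun j => ?_) fun i => Fin.cases ?_ fun j => ?_
      · simpa [u] using hm
      · simpa [u] using h2 j
      · simpa [u] using h1 i
      · simpa [u] using h3 i j
    obtain ⟨k, hk⟩ := Finite.exists_min u
    refine ⟨fun i => u i - u k, ?_, ?_⟩
    · rw [Finset.mem_coe, mem_normalizedPoints]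
      exact ⟨fun i => ⟨sub_nonneg.2 (hk i), hu i k⟩, k, sub_self _⟩
    · funext i
      simp [translatedChart, u]
  · rintro ⟨f, hf, rfl⟩
    rw [Finset.mem_coe, mem_normalizedPoints] at hf
    have hf := hf.1
    simp only [translatedChart, add_sub_cancel_left]
    refine ⟨fun i => ?_, fun i => ?_, fun i j => ?_⟩
    · have := hf i.succ
      have := hf 0
      omega
    · have := hf i.succ
      have := hf 0
      omega
    · have := hf i.succ
      have := hf j.succ
      omega

/-- The number of integer points in a translated Hilbert ball
`v + B_H(δ) ⊆ ℝ^(d-1)` equals `(⌊δ⌋+1)^d − ⌊δ⌋^d` (independently of `v`). -/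
theorem stmt0 (d : ℕ) (hd : 2 ≤ d) (δ : ℝ) (hδ : 0 < δ) (v : Fin (d - 1) → ℤ) :
    (Set.ncard {w : Fin (d - 1) → ℤ |
        (fun i => (w i : ℝ)) ∈ ((fun i => (v i : ℝ)) + ·) '' hilbertBall (d - 1) δ} : ℤ) =
      (⌊δ⌋ + 1) ^ d - ⌊δ⌋ ^ d := by
  obtain ⟨n, rfl⟩ : ∃ n, d = n + 1 := ⟨d - 1, by omega⟩
  have : NeZero n := ⟨by omega⟩
  change Fin n → ℤ at v
  refine (congrArg (fun s : Set (Fin n → ℤ) => (s.ncard : ℤ))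
    (image_translatedChart hδ.le v)).trans ?_
  rw [(injOn_translatedChart _ v).ncard_image,
    Set.ncard_coe_finset, card_normalizedPoints n (Int.floor_nonneg.2 hδ.le)]
end
end

section
/- Let d ≥ 2 be an integer and δ > 0 a rational number. Then the Lebesgue measure of the Hilbert ball B_H(δ) ⊆ ℝ^{d−1} equals d·δ^{d−1}. -/
open MeasureTheory Pointwise

noncomputable section

/-- The linear involution of `ℝ^n` sending `y` to the vector with `i`-th entry `-y i` and
`j`-th entry `y j - y i` for `j ≠ i`. -/
def hilbertShear {n : ℕ} (i : Fin n) : (Fin n → ℝ) →ₗ[ℝ] (Fin n → ℝ) :=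
  LinearMap.id - (LinearMap.proj i : (Fin n → ℝ) →ₗ[ℝ] ℝ).smulRight (1 + Pi.single i 1)

lemma hilbertShear_apply_self {n : ℕ} (i : Fin n) (y : Fin n → ℝ) :
    hilbertShear i y i = -y i := by
  simp [hilbertShear]

lemma hilbertShear_apply_of_ne {n : ℕ} {i j : Fin n} (h : j ≠ i) (y : Fin n → ℝ) :
    hilbertShear i y j = y j - y i := by
  simp [hilbertShear, h]

lemma hilbertShear_comp_self {n : ℕ} (i : Fin n) :
    hilbertShear i ∘ₗ hilbertShear i = LinearMap.id := by
  refine LinearMap.ext fun y => funext fun j => ?_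
  by_cases h : j = i
  · subst h; simp [hilbertShear_apply_self]
  · simp [hilbertShear_apply_self, hilbertShear_apply_of_ne h]

lemma abs_det_hilbertShear {n : ℕ} (i : Fin n) : |LinearMap.det (hilbertShear i)| = 1 := by
  have h := congrArg LinearMap.det (hilbertShear_comp_self i)
  rw [LinearMap.det_comp, LinearMap.det_id] at h
  rcases mul_self_eq_one_iff.mp h with h | h <;> simp [h]

lemma volume_preimage_hilbertShear {n : ℕ} (i : Fin n) (s : Set (Fin n → ℝ)) :
    volume (hilbertShear i ⁻¹' s) = volume s := by
  have h := abs_det_hilbertShear i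
  have h0 : LinearMap.det (hilbertShear i) ≠ 0 := by
    intro h0; simp [h0] at h
  rw [Measure.addHaar_preimage_linearMap volume h0, abs_inv, h]
  simp

lemma volume_ker_eq_zero {n : ℕ} {f : (Fin n → ℝ) →ₗ[ℝ] ℝ} (hf : f ≠ 0) :
    volume {y | f y = 0} = 0 :=
  Measure.addHaar_submodule volume (LinearMap.ker f) (mt LinearMap.ker_eq_top.mp hf)

/-- The part of the Hilbert ball where the least of the numbers `0, y 0, …, y (n - 1)` is `0`
(for `none`) or `y i` (for `some i`). -/
def hilbertPiece (n : ℕ) (δ : ℝ) : Option (Fin n) → Set (Fin n → ℝ)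
  | none => Set.Icc 0 (fun _ => δ)
  | some i => hilbertShear i ⁻¹' Set.Icc 0 (fun _ => δ)

lemma mem_hilbertPiece_none {n : ℕ} {δ : ℝ} {y : Fin n → ℝ} :
    y ∈ hilbertPiece n δ none ↔ ∀ j, 0 ≤ y j ∧ y j ≤ δ := by
  simp [hilbertPiece, Pi.le_def, forall_and]

lemma mem_hilbertPiece_some {n : ℕ} {δ : ℝ} (hδ : 0 ≤ δ) {i : Fin n} {y : Fin n → ℝ} :
    y ∈ hilbertPiece n δ (some i) ↔
      (y i ≤ 0 ∧ -y i ≤ δ) ∧ ∀ j, y i ≤ y j ∧ y j ≤ y i + δ := by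
  simp only [hilbertPiece, Set.mem_preimage, Set.mem_Icc, Pi.le_def, ← forall_and, Pi.zero_apply]
  constructor
  · intro h
    have hi := h i
    rw [hilbertShear_apply_self] at hi
    refine ⟨⟨by linarith, hi.2⟩, fun j => ?_⟩
    by_cases hj : j = i
    · subst hj; exact ⟨le_rfl, by linarith⟩
    · have := h j
      rw [hilbertShear_apply_of_ne hj] at this
      constructor <;> linarith
  · rintro ⟨hi, h⟩ j
    by_cases hj : j = i
    · subst hj; rw [hilbertShear_apply_self]; exact ⟨by linarith, hi.2⟩
    · rw [hilbertShear_apply_of_ne hj]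
      have := h j
      constructor <;> linarith

lemma volume_hilbertPiece (n : ℕ) (δ : ℝ) (o : Option (Fin n)) :
    volume (hilbertPiece n δ o) = ENNReal.ofReal δ ^ n := by
  cases o <;> simp [hilbertPiece, volume_preimage_hilbertShear, Real.volume_Icc_pi]

lemma measurableSet_hilbertPiece (n : ℕ) (δ : ℝ) (o : Option (Fin n)) :
    MeasurableSet (hilbertPiece n δ o) := by
  cases o with
  | none => exact measurableSet_Icc
  | some i => exact (hilbertShear i).continuous_of_finiteDimensional.measurable measurableSet_Icc

lemma aedisjoint_hilbertPiece_none_some {n : ℕ} {δ : ℝ} (hδ : 0 ≤ δ) (i : Fin n) :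
    AEDisjoint volume (hilbertPiece n δ none) (hilbertPiece n δ (some i)) := by
  have hf : (LinearMap.proj i : (Fin n → ℝ) →ₗ[ℝ] ℝ) ≠ 0 := fun h => by
    simpa using LinearMap.congr_fun h (Pi.single i 1)
  refine measure_mono_null ?_ (volume_ker_eq_zero hf)
  rintro y ⟨h₁, h₂⟩
  rw [mem_hilbertPiece_none] at h₁
  rw [mem_hilbertPiece_some hδ] at h₂
  exact le_antisymm h₂.1.1 (h₁ i).1

lemma pairwise_aedisjoint_hilbertPiece {n : ℕ} {δ : ℝ} (hδ : 0 ≤ δ) :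
    Pairwise (Function.onFun (AEDisjoint volume) (hilbertPiece n δ)) := by
  rintro (_ | i) (_ | j) hij
  · exact absurd rfl hij
  · exact aedisjoint_hilbertPiece_none_some hδ j
  · exact (aedisjoint_hilbertPiece_none_some hδ i).symm
  · have hne : i ≠ j := fun h => hij (congrArg some h)
    have hf : (LinearMap.proj i : (Fin n → ℝ) →ₗ[ℝ] ℝ) - LinearMap.proj j ≠ 0 := fun h => by
      simpa [hne.symm] using LinearMap.congr_fun h (Pi.single i 1)
    refine measure_mono_null ?_ (volume_ker_eq_zero hf)
    rintro y ⟨h₁, h₂⟩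
    rw [mem_hilbertPiece_some hδ] at h₁ h₂
    exact sub_eq_zero.mpr (le_antisymm (h₁.2 j).1 (h₂.2 i).1)

lemma hilbertBall_eq_iUnion_hilbertPiece {n : ℕ} [NeZero n] {δ : ℝ} (hδ : 0 ≤ δ) :
    hilbertBall n δ = ⋃ o, hilbertPiece n δ o := by
  ext y
  have of_bounds (a : ℝ) (ha : a ≤ 0) (hb : 0 ≤ a + δ) (h : ∀ j, a ≤ y j ∧ y j ≤ a + δ) :
      y ∈ hilbertBall n δ := by
    have h₁ : max 0 (⨆ i, y i) ≤ a + δ := max_le hb (ciSup_le fun j => (h j).2)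
    have h₂ : a ≤ min 0 (⨅ i, y i) := le_min ha (le_ciInf fun j => (h j).1)
    change max 0 (⨆ i, y i) - min 0 (⨅ i, y i) ≤ δ
    linarith
  simp only [Set.mem_iUnion, Option.exists, mem_hilbertPiece_none, mem_hilbertPiece_some hδ]
  constructor
  · intro h
    change max 0 (⨆ i, y i) - min 0 (⨅ i, y i) ≤ δ at h
    obtain ⟨m, hm⟩ := exists_eq_ciInf_of_finite (f := y)
    have hle (j : Fin n) : y m ≤ y j := hm ▸ ciInf_le (Set.finite_range y).bddBelow j
    have hsup (j : Fin n) : y j ≤ max 0 (⨆ i, y i) :=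
      (le_ciSup (Set.finite_range y).bddAbove j).trans (le_max_right _ _)
    have hzero : 0 ≤ max 0 (⨆ i, y i) := le_max_left _ _
    rw [← hm] at h
    rcases le_total 0 (y m) with h0 | h0
    · rw [min_eq_left h0] at h
      exact Or.inl fun j => ⟨h0.trans (hle j), by linarith [hsup j]⟩
    · rw [min_eq_right h0] at h
      exact Or.inr ⟨m, ⟨h0, by linarith⟩, fun j => ⟨hle j, by linarith [hsup j]⟩⟩
  · rintro (h | ⟨i, ⟨h0, h1⟩, h⟩)
    · exact of_bounds 0 le_rfl (by simpa using hδ) (by simpa using h)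
    · exact of_bounds (y i) h0 (by linarith) h

theorem volume_hilbertBall (n : ℕ) [NeZero n] {δ : ℝ} (hδ : 0 ≤ δ) :
    volume (hilbertBall n δ) = ENNReal.ofReal ((n + 1) * δ ^ n) := by
  rw [hilbertBall_eq_iUnion_hilbertPiece hδ,
    measure_iUnion₀ (pairwise_aedisjoint_hilbertPiece hδ)
      fun o => (measurableSet_hilbertPiece n δ o).nullMeasurableSet,
    ENNReal.ofReal_mul (by positivity), ENNReal.ofReal_pow hδ]
  have hcast : ENNReal.ofReal ((n : ℝ) + 1) = (n : ENNReal) + 1 := by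
    exact_mod_cast ENNReal.ofReal_natCast (n + 1)
  simp [volume_hilbertPiece, tsum_fintype, hcast]

/-- The Lebesgue measure of the Hilbert ball `B_H(δ) ⊆ ℝ^(d-1)`, for rational `δ > 0`,
equals `d·δ^(d-1)`. -/
theorem stmt1 (d : ℕ) (hd : 2 ≤ d) (δ : ℚ) (hδ : 0 < δ) :
    volume (hilbertBall (d - 1) (δ : ℝ)) = ENNReal.ofReal (d * (δ : ℝ) ^ (d - 1)) := by
  have : NeZero (d - 1) := ⟨by omega⟩
  have hδ' : (0 : ℝ) ≤ δ := by exact_mod_cast hδ.le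
  rw [volume_hilbertBall (d - 1) hδ', Nat.cast_sub (by omega)]
  simp
end
end

section
/- Let m ≥ 2, let B assign a real value B_{ij} to every ordered pair of distinct indices 1 ≤ i ≠ j ≤ m, and let X = {x ∈ ℝ^m : x_1 = 0 and x_i − x_j ≤ B_{ij} for all i ≠ j}, identified with a subset of ℝ^{m−1} via the coordinates (x_2, …, x_m). Suppose δ > 0 and u ∈ ℝ^m satisfy u_i − u_j ≤ B_{ij} − δ for all i ≠ j. Then: (1) the Lebesgue measure of X in ℝ^{m−1} is at least m·δ^{m−1}; and (2) if moreover u ∈ ℤ^m, then the number of integer points of X, i.e. |X ∩ ℤ^{m−1}|, is at least (⌊δ⌋+1)^m − ⌊δ⌋^m. -/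
open MeasureTheory Pointwise

noncomputable section

/-- Extension of a point of `ℝ^(m-1)` to `ℝ^m` with first coordinate `0`
(the inverse of the chart `x ↦ (x_2, …, x_m)` on `{x : x_1 = 0}`). -/
def extZero (m : ℕ) (y : Fin (m - 1) → ℝ) : Fin m → ℝ :=
  fun i => if h : (i : ℕ) = 0 then 0 else y ⟨(i : ℕ) - 1, by have := i.isLt; omega⟩

theorem extZero_succ (n : ℕ) (y : Fin n → ℝ) : extZero (n + 1) y = Fin.cons 0 y := by
  ext i
  refine Fin.cases ?_ (fun j => ?_) i <;> simp [extZero]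

theorem extZero_sub_le_of_sub_le {n : ℕ} {B : Fin (n + 1) → Fin (n + 1) → ℝ} {δ : ℝ}
    {u : Fin (n + 1) → ℝ} (hu : ∀ i j, i ≠ j → u i - u j ≤ B i j - δ) {y : Fin n → ℝ}
    (hy : ∀ i j : Fin (n + 1),
      (Fin.cons 0 y : Fin (n + 1) → ℝ) i - (Fin.cons 0 y : Fin (n + 1) → ℝ) j ≤ δ)
    (i j : Fin (n + 1)) (hij : i ≠ j) :
    extZero (n + 1) (fun i => y i + (u i.succ - u 0)) i
      - extZero (n + 1) (fun i => y i + (u i.succ - u 0)) j ≤ B i j := by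
  have key : ∀ k, extZero (n + 1) (fun i => y i + (u i.succ - u 0)) k
      = (Fin.cons 0 y : Fin (n + 1) → ℝ) k + (u k - u 0) := by
    intro k
    rw [extZero_succ]
    refine Fin.cases ?_ (fun l => ?_) k <;> simp
  rw [key, key]
  linarith [hy i j, hu i j hij]

/-- The part of the interior of the Hilbert ball of radius `δ` around `0`, in the chart
`x_1 = 0`, on which the coordinate `k` is the strict minimum. -/
def minCell (n : ℕ) (δ : ℝ) (k : Fin (n + 1)) : Set (Fin n → ℝ) :=
  {y | ∀ i, i ≠ k →
    (Fin.cons 0 y : Fin (n + 1) → ℝ) i - (Fin.cons 0 y : Fin (n + 1) → ℝ) k ∈ Set.Ioo 0 δ}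

theorem measurableSet_minCell (n : ℕ) (δ : ℝ) (k : Fin (n + 1)) :
    MeasurableSet (minCell n δ k) := by
  have hc : ∀ i : Fin (n + 1),
      Continuous fun y : Fin n → ℝ => (Fin.cons 0 y : Fin (n + 1) → ℝ) i :=
    fun i => by refine Fin.cases ?_ (fun j => ?_) i <;> simp <;> fun_prop
  simp only [minCell, Set.ofPred_forall]
  refine MeasurableSet.iInter fun i => MeasurableSet.iInter fun _ => ?_
  exact (isOpen_Ioo.preimage ((hc i).sub (hc k))).measurableSet

theorem pairwise_disjoint_minCell (n : ℕ) (δ : ℝ) :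
    Pairwise (Function.onFun Disjoint (minCell n δ)) := by
  intro k l hkl
  refine Set.disjoint_left.2 fun y hk hl => ?_
  have h1 := (hk l hkl.symm).1
  have h2 := (hl k hkl).1
  linarith

theorem sub_le_of_mem_minCell {n : ℕ} {δ : ℝ} (hδ : 0 < δ) {k : Fin (n + 1)} {y : Fin n → ℝ}
    (hy : y ∈ minCell n δ k) (i j : Fin (n + 1)) :
    (Fin.cons 0 y : Fin (n + 1) → ℝ) i - (Fin.cons 0 y : Fin (n + 1) → ℝ) j ≤ δ := by
  have key : ∀ i, 0 ≤ (Fin.cons 0 y : Fin (n + 1) → ℝ) i - (Fin.cons 0 y : Fin (n + 1) → ℝ) k ∧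
      (Fin.cons 0 y : Fin (n + 1) → ℝ) i - (Fin.cons 0 y : Fin (n + 1) → ℝ) k ≤ δ := by
    intro i
    by_cases h : i = k
    · simp [h, hδ.le]
    · exact ⟨(hy i h).1.le, (hy i h).2.le⟩
  linarith [(key i).2, (key j).1]

theorem volume_minCell (n : ℕ) (δ : ℝ) (k : Fin (n + 1)) :
    volume (minCell n δ k) = ENNReal.ofReal δ ^ n := by
  refine Fin.cases ?_ (fun j => ?_) k
  · have : minCell n δ 0 = Set.univ.pi fun _ => Set.Ioo 0 δ := by
      ext y
      simp [minCell, Fin.forall_fin_succ]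
    rw [this, Real.volume_pi_Ioo]
    simp
  · set v : Fin n → ℝ := fun i => if i = j then 0 else -1 with hv
    set f : (Fin n → ℝ) →ₗ[ℝ] (Fin n → ℝ) :=
      LinearMap.transvection (LinearMap.proj j : (Fin n → ℝ) →ₗ[ℝ] ℝ) v with hf
    have hdet : LinearMap.det f = 1 := by
      rw [hf, LinearMap.transvection.det]
      simp [hv]
    have hpre : minCell n δ j.succ = f ⁻¹' (Set.univ.pi fun i =>
        Set.Ioo (if i = j then -δ else 0) (if i = j then 0 else δ)) := by
      ext y
      simp only [minCell, Fin.forall_fin_succ, Set.mem_ofPred_eq, Set.mem_preimage,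
        Set.mem_univ_pi, Fin.cons_zero, Fin.cons_succ, hf, hv, LinearMap.transvection.apply,
        LinearMap.proj_apply, Pi.add_apply, Pi.smul_apply, smul_eq_mul, Set.mem_Ioo,
        ne_eq, Fin.succ_inj]
      constructor
      · rintro ⟨h0, h⟩ i
        have h0 := h0 (Fin.succ_ne_zero j).symm
        by_cases hi : i = j
        · subst hi
          simp only [if_true]
          constructor <;> linarith [h0.1, h0.2]
        · simp only [hi, if_false]
          constructor <;> linarith [(h i hi).1, (h i hi).2]
      · intro h
        refine ⟨fun _ => ?_, fun i hi => ?_⟩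
        · have := h j
          simp only [if_true] at this
          constructor <;> linarith [this.1, this.2]
        · have := h i
          simp only [hi, if_false] at this
          constructor <;> linarith [this.1, this.2]
    rw [hpre, Measure.addHaar_preimage_linearMap _ (by simp [hdet]), hdet, Real.volume_pi_Ioo]
    have : ∀ i : Fin n, ((if i = j then 0 else δ) - (if i = j then -δ else 0) : ℝ) = δ := by
      intro i
      split_ifs <;> ring
    simp [this]

theorem ofReal_le_volume_polytrope {n : ℕ} {B : Fin (n + 1) → Fin (n + 1) → ℝ} {δ : ℝ}
    (hδ : 0 < δ) {u : Fin (n + 1) → ℝ} (hu : ∀ i j, i ≠ j → u i - u j ≤ B i j - δ) :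
    ENNReal.ofReal ((n + 1 : ℕ) * δ ^ n) ≤ volume {y : Fin n → ℝ |
      ∀ i j : Fin (n + 1), i ≠ j → extZero (n + 1) y i - extZero (n + 1) y j ≤ B i j} := by
  have hvol : volume (⋃ k, minCell n δ k) = ENNReal.ofReal ((n + 1 : ℕ) * δ ^ n) := by
    rw [measure_iUnion (pairwise_disjoint_minCell n δ) (measurableSet_minCell n δ)]
    simp only [volume_minCell, tsum_fintype, Finset.sum_const, Finset.card_univ,
      Fintype.card_fin, nsmul_eq_mul]
    rw [ENNReal.ofReal_mul (by positivity), ENNReal.ofReal_natCast, ENNReal.ofReal_pow hδ.le]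
  rw [← hvol, ← measure_preimage_add_right volume (fun i : Fin n => u i.succ - u 0) {y |
      ∀ i j : Fin (n + 1), i ≠ j → extZero (n + 1) y i - extZero (n + 1) y j ≤ B i j}]
  refine measure_mono (Set.iUnion_subset fun k y hy => ?_)
  exact extZero_sub_le_of_sub_le hu (sub_le_of_mem_minCell hδ hy)

theorem finite_integer_points_polytrope (n : ℕ) (B : Fin (n + 1) → Fin (n + 1) → ℝ) :
    {w : Fin n → ℤ | ∀ i j : Fin (n + 1), i ≠ j →
      extZero (n + 1) (fun i => (w i : ℝ)) i - extZero (n + 1) (fun i => (w i : ℝ)) j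
        ≤ B i j}.Finite := by
  refine (Set.finite_Icc (fun i : Fin n => ⌈-B 0 i.succ⌉)
    (fun i : Fin n => ⌊B i.succ 0⌋)).subset fun w hw => ⟨fun i => ?_, fun i => ?_⟩
  · have := hw 0 i.succ (Fin.succ_ne_zero i).symm
    simp only [extZero_succ, Fin.cons_zero, Fin.cons_succ] at this
    exact Int.ceil_le.2 (by linarith)
  · have := hw i.succ 0 (Fin.succ_ne_zero i)
    simp only [extZero_succ, Fin.cons_zero, Fin.cons_succ] at this
    exact Int.le_floor.2 (by linarith)

/-- The integer points of the cube `[0, d]^n` having at least one vanishing coordinate. -/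
def lowerFaces (n d : ℕ) : Finset (Fin n → ℤ) :=
  (Fintype.piFinset fun _ => Finset.Icc 0 (d : ℤ)) \
    Fintype.piFinset fun _ => Finset.Icc 1 (d : ℤ)

theorem card_lowerFaces (n d : ℕ) : ((lowerFaces n d).card : ℤ) = (d + 1) ^ n - d ^ n := by
  rw [lowerFaces, Finset.cast_card_sdiff]
  · simp [Fintype.card_piFinset]
  · exact Fintype.piFinset_subset _ _ fun _ => Finset.Icc_subset_Icc_left zero_le_one

theorem mem_lowerFaces {n d : ℕ} {a : Fin n → ℤ} :
    a ∈ lowerFaces n d ↔ (∀ i, 0 ≤ a i ∧ a i ≤ d) ∧ ∃ i, a i = 0 := by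
  simp only [lowerFaces, Finset.mem_sdiff, Fintype.mem_piFinset, Finset.mem_Icc, not_forall]
  refine and_congr_right fun h => exists_congr fun i => ?_
  have := h i
  omega

theorem le_ncard_integer_points_polytrope {n : ℕ} {B : Fin (n + 1) → Fin (n + 1) → ℝ} {δ : ℝ}
    (hδ : 0 ≤ δ) {z : Fin (n + 1) → ℤ}
    (hz : ∀ i j, i ≠ j → (z i : ℝ) - z j ≤ B i j - δ) :
    ((⌊δ⌋ + 1) ^ (n + 1) - ⌊δ⌋ ^ (n + 1) : ℤ) ≤
      ({w : Fin n → ℤ | ∀ i j : Fin (n + 1), i ≠ j →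
        extZero (n + 1) (fun i => (w i : ℝ)) i - extZero (n + 1) (fun i => (w i : ℝ)) j
          ≤ B i j}.ncard : ℤ) := by
  obtain ⟨d, hd⟩ := Int.eq_ofNat_of_zero_le (Int.floor_nonneg.2 hδ)
  have hdδ : (d : ℝ) ≤ δ := by
    have := Int.floor_le δ
    rwa [hd, Int.cast_natCast] at this
  rw [hd, ← card_lowerFaces, ← Set.ncard_coe_finset]
  refine Nat.cast_le.2 (Set.ncard_le_ncard_of_injOn
    (fun a i => a i.succ - a 0 + (z i.succ - z 0)) ?_ ?_ (finite_integer_points_polytrope n B))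
  · intro a ha
    rw [Finset.mem_coe, mem_lowerFaces] at ha
    have key : ∀ k, (Fin.cons 0 (fun i : Fin n => (a i.succ - a 0 : ℝ)) : Fin (n + 1) → ℝ) k
        = a k - a 0 := by
      intro k
      refine Fin.cases ?_ (fun l => ?_) k <;> simp
    have := extZero_sub_le_of_sub_le (u := fun i => (z i : ℝ)) hz
      (y := fun i => (a i.succ - a 0 : ℝ)) (fun i j => by
        rw [key, key]
        have h1 : (a i : ℝ) ≤ d := by exact_mod_cast (ha.1 i).2
        have h2 : (0 : ℝ) ≤ a j := by exact_mod_cast (ha.1 j).1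
        linarith)
    simpa using this
  · intro a ha b hb hab
    rw [Finset.mem_coe, mem_lowerFaces] at ha hb
    have key : ∀ i, a i - a 0 = b i - b 0 := by
      intro i
      refine Fin.cases (by simp) (fun j => ?_) i
      have := congrFun hab j
      simp only at this
      omega
    obtain ⟨p, hp⟩ := ha.2
    obtain ⟨q, hq⟩ := hb.2
    ext i
    have := key i
    have := key p
    have := key q
    have := ha.1 q
    have := hb.1 p
    omega

/-- If the Hilbert ball of radius `δ` centered at `u` is inscribed in the polytrope
`X = {x : x_1 = 0, x_i − x_j ≤ B i j}` (viewed in `ℝ^(m-1)`), then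
(1) the volume of `X` is at least `m·δ^(m-1)`, and
(2) if `u` is integral, `X` contains at least `(⌊δ⌋+1)^m − ⌊δ⌋^m` integer points. -/
theorem stmt3 (m : ℕ) (hm : 2 ≤ m) (B : Fin m → Fin m → ℝ) (δ : ℝ) (hδ : 0 < δ)
    (u : Fin m → ℝ) (hu : ∀ i j : Fin m, i ≠ j → u i - u j ≤ B i j - δ) :
    (ENNReal.ofReal (m * δ ^ (m - 1)) ≤
      volume {y : Fin (m - 1) → ℝ |
        ∀ i j : Fin m, i ≠ j → extZero m y i - extZero m y j ≤ B i j}) ∧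
    ((∀ i, ∃ z : ℤ, u i = (z : ℝ)) →
      ((⌊δ⌋ + 1) ^ m - ⌊δ⌋ ^ m : ℤ) ≤
        (Set.ncard {w : Fin (m - 1) → ℤ | (fun i => (w i : ℝ)) ∈
          {y : Fin (m - 1) → ℝ |
            ∀ i j : Fin m, i ≠ j → extZero m y i - extZero m y j ≤ B i j}} : ℤ)) := by
  obtain ⟨n, rfl⟩ : ∃ n, m = n + 1 := ⟨m - 1, by omega⟩
  refine ⟨ofReal_le_volume_polytrope hδ hu, fun hz => ?_⟩
  choose z hz using hz
  simp only [hz] at hu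
  exact le_ncard_integer_points_polytrope hδ.le hu
end
end

section
/- Let m ≥ 2 and let B assign an integer value B_{ij} ∈ ℤ to every ordered pair of distinct indices 1 ≤ i ≠ j ≤ m. Let X = {x ∈ ℝ^m : x_1 = 0 and x_i − x_j ≤ B_{ij} for all i ≠ j}, identified with a subset of ℝ^{m−1} via (x_2,…,x_m). If X has nonempty interior in ℝ^{m−1}, then ρ_min(B) = z/t for some positive integer z and some t ∈ {1,…,m}; in particular ρ_min(B) ≥ 1/m > 0. -/
open MeasureTheory Pointwise

noncomputable section

/-- Minimum cycle mean of the weights `B` on ordered pairs of distinct indices of `Fin m`: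
the minimum over all `r ∈ {2,…,m}` and tuples `(i₁,…,i_r)` of distinct indices of
`(B i₁ i₂ + ⋯ + B i_{r-1} i_r + B i_r i₁) / r`. -/
noncomputable def minCycleMean (m : ℕ) (B : Fin m → Fin m → ℝ) : ℝ :=
  sInf {w : ℝ | ∃ r : ℕ, 2 ≤ r ∧ r ≤ m ∧ ∃ c : Fin r → Fin m, Function.Injective c ∧
    w = (∑ t : Fin r, B (c t) (c (finRotate r t))) / r}

lemma extZero_add_smul (m : ℕ) (y d : Fin (m - 1) → ℝ) (s : ℝ) (i : Fin m) :
    extZero m (y + s • d) i = extZero m y i + s * extZero m d i := by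
  unfold extZero
  split_ifs <;> simp

lemma exists_extZero_lt (m : ℕ) {i j : Fin m} (hij : i ≠ j) :
    ∃ d : Fin (m - 1) → ℝ, extZero m d j < extZero m d i := by
  refine ⟨fun k => (if (k : ℕ) + 1 = i then 1 else 0) - (if (k : ℕ) + 1 = j then 1 else 0), ?_⟩
  have hval : (i : ℕ) ≠ j := fun h => hij (Fin.ext h)
  unfold extZero
  by_cases hi : (i : ℕ) = 0
  · have hj : (j : ℕ) ≠ 0 := by omega
    have h1 : (j : ℕ) - 1 + 1 = j := by omega
    simp [hi, hj, h1]
  · have h1 : (i : ℕ) - 1 + 1 = i := by omega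
    by_cases hj : (j : ℕ) = 0
    · simp [hi, hj, h1]
    · have h2 : (j : ℕ) - 1 + 1 = j := by omega
      simp only [hi, hj, h1, h2, hval, hval.symm, dite_false, if_true, if_false]
      norm_num

/-- The defining inequalities are strict at interior points. -/
lemma extZero_sub_lt_of_mem_interior {m : ℕ} {B : Fin m → Fin m → ℝ} {y : Fin (m - 1) → ℝ}
    (hy : y ∈ interior {y : Fin (m - 1) → ℝ |
      ∀ i j : Fin m, i ≠ j → extZero m y i - extZero m y j ≤ B i j})
    {i j : Fin m} (hij : i ≠ j) : extZero m y i - extZero m y j < B i j := by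
  obtain ⟨d, hd⟩ := exists_extZero_lt m hij
  have hcont : Filter.Tendsto (fun s : ℝ => y + s • d) (nhds 0) (nhds y) :=
    (show Continuous fun s : ℝ => y + s • d by fun_prop).tendsto' 0 y (by simp)
  have hmem := hcont.eventually (mem_interior_iff_mem_nhds.1 hy)
  obtain ⟨s, hs, hs0⟩ := ((hmem.filter_mono nhdsWithin_le_nhds).and
    (self_mem_nhdsWithin : ∀ᶠ s in nhdsWithin (0 : ℝ) (Set.Ioi 0), s ∈ Set.Ioi 0)).exists
  have h := hs i j hij
  rw [extZero_add_smul, extZero_add_smul] at h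
  nlinarith [mul_pos (Set.mem_Ioi.1 hs0) (sub_pos.2 hd)]

/-- Weights dominating differences of a potential strictly have positive cycle sums. -/
lemma cycle_sum_pos {ι : Type*} {B : ι → ι → ℝ} {x : ι → ℝ}
    (hx : ∀ i j, i ≠ j → x i - x j < B i j) {r : ℕ} (hr : 2 ≤ r) {c : Fin r → ι}
    (hc : Function.Injective c) : 0 < ∑ t : Fin r, B (c t) (c (finRotate r t)) := by
  have hne : ∀ t : Fin r, c t ≠ c (finRotate r t) := fun t h => by
    obtain ⟨n, rfl⟩ : ∃ n, r = n + 2 := ⟨r - 2, by omega⟩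
    have heq := hc h
    rw [finRotate_apply] at heq
    simp at heq
  have : Nonempty (Fin r) := ⟨⟨0, by omega⟩⟩
  calc (0 : ℝ) = ∑ t : Fin r, (x (c t) - x (c (finRotate r t))) := by
        rw [Finset.sum_sub_distrib, Equiv.sum_comp (finRotate r) fun t => x (c t), sub_self]
    _ < _ := Finset.sum_lt_sum_of_nonempty Finset.univ_nonempty fun t _ => hx _ _ (hne t)

/-- The minimum in the definition of `minCycleMean` is attained. -/
lemma exists_minCycleMean_eq {m : ℕ} (hm : 2 ≤ m) (B : Fin m → Fin m → ℝ) :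
    ∃ r : ℕ, 2 ≤ r ∧ r ≤ m ∧ ∃ c : Fin r → Fin m, Function.Injective c ∧
      minCycleMean m B = (∑ t : Fin r, B (c t) (c (finRotate r t))) / r := by
  refine Set.Nonempty.csInf_mem (s := {w : ℝ | ∃ r : ℕ, 2 ≤ r ∧ r ≤ m ∧
    ∃ c : Fin r → Fin m, Function.Injective c ∧
      w = (∑ t : Fin r, B (c t) (c (finRotate r t))) / r}) ?_ ?_
  · exact ⟨_, 2, le_rfl, hm, Fin.castLE hm, Fin.castLE_injective hm, rfl⟩
  · refine (Set.finite_range fun p : Σ r : Fin (m + 1), (Fin r → Fin m) =>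
      (∑ t, B (p.2 t) (p.2 (finRotate p.1 t))) / ((p.1 : ℕ) : ℝ)).subset ?_
    rintro w ⟨r, -, hrm, c, -, rfl⟩
    exact ⟨⟨⟨r, by omega⟩, c⟩, rfl⟩

/-- If the full-dimensional polytrope defined by an integer matrix `B` has nonempty
interior in `ℝ^(m-1)`, then `ρ_min(B) = z/t` with `z` a positive integer and
`t ∈ {1,…,m}`; in particular `ρ_min(B) ≥ 1/m`. -/
theorem stmt4 (m : ℕ) (hm : 2 ≤ m) (B : Fin m → Fin m → ℤ)
    (hX : (interior {y : Fin (m - 1) → ℝ |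
        ∀ i j : Fin m, i ≠ j → extZero m y i - extZero m y j ≤ (B i j : ℝ)}).Nonempty) :
    (∃ z : ℕ, 0 < z ∧ ∃ t : ℕ, 1 ≤ t ∧ t ≤ m ∧
        minCycleMean m (fun i j => (B i j : ℝ)) = (z : ℝ) / (t : ℝ)) ∧
      1 / (m : ℝ) ≤ minCycleMean m (fun i j => (B i j : ℝ)) := by
  obtain ⟨y, hy⟩ := hX
  obtain ⟨r, hr, hrm, c, hc, hmin⟩ := exists_minCycleMean_eq hm fun i j => (B i j : ℝ)
  have hpos := cycle_sum_pos (B := fun i j => (B i j : ℝ))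
    (fun i j hij => extZero_sub_lt_of_mem_interior (B := fun i j => (B i j : ℝ)) hy hij) hr hc
  rw [hmin]
  rw [← Int.cast_sum] at hpos ⊢
  obtain ⟨z, hz⟩ := Int.eq_ofNat_of_zero_le (Int.cast_pos.1 hpos).le
  rw [hz, Int.cast_natCast] at hpos ⊢
  have hz0 : 0 < z := Nat.cast_pos.1 hpos
  refine ⟨⟨z, hz0, r, by omega, hrm, rfl⟩, ?_⟩
  have hr0 : (0 : ℝ) < r := by exact_mod_cast (by omega : 0 < r)
  exact div_le_div₀ hpos.le (by exact_mod_cast hz0) hr0 (by exact_mod_cast hrm)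
end
end

section
/- Let A ∈ ℝ^{m×n} and H ∈ ℝ^{m×p} with m ≥ 2. Let M ∈ ℝ^{m×np} be the matrix whose columns are all sums A_j + H_k of a column of A and a column of H. Then the Minkowski sum tconv(A) + tconv(H) ⊆ ℝ^{m−1} is contained in tconv(M); i.e. the points A_j + H_k form a (possibly non-minimal) family of generators for the Hilbert outer parallel body construction. -/
open MeasureTheory Pointwise

noncomputable section

/-- Tropical (min-plus) convex hull of the columns of a matrix `A`, viewed in the chart
`x ↦ (x_2 − x_1, …, x_m − x_1)`, i.e. as a subset of `ℝ^(m-1)`. -/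
def tconv (m : ℕ) {ι : Type*} (A : Fin m → ι → ℝ) : Set (Fin (m - 1) → ℝ) :=
  {y | ∃ α : ι → ℝ, ∀ k : Fin (m - 1),
      y k = (⨅ j, (α j + A ⟨(k : ℕ) + 1, by have := k.isLt; omega⟩ j))
          - (⨅ j, (α j + A ⟨0, by have := k.isLt; omega⟩ j))}

/-- The infimum of a family of sums over a finite product splits as a sum of infima. -/
theorem ciInf_prod_add {ι κ : Type*} [Finite ι] [Nonempty ι] [Finite κ] [Nonempty κ]
    (f : ι → ℝ) (g : κ → ℝ) :
    (⨅ jk : ι × κ, (f jk.1 + g jk.2)) = (⨅ j, f j) + ⨅ k, g k := by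
  apply le_antisymm
  · obtain ⟨j, hj⟩ := exists_eq_ciInf_of_finite (f := f)
    obtain ⟨k, hk⟩ := exists_eq_ciInf_of_finite (f := g)
    rw [← hj, ← hk]
    exact ciInf_le (Set.finite_range _).bddBelow (j, k)
  · exact le_ciInf fun jk => add_le_add
      (ciInf_le (Set.finite_range f).bddBelow jk.1) (ciInf_le (Set.finite_range g).bddBelow jk.2)

/-- The Minkowski sum `tconv(A) + tconv(H)` is contained in the tropical polytope
generated by all the column sums `A_j + H_k`. -/
theorem stmt6 (m n p : ℕ) (hm : 2 ≤ m) (hn : 1 ≤ n) (hp : 1 ≤ p)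
    (A : Fin m → Fin n → ℝ) (H : Fin m → Fin p → ℝ) :
    tconv m A + tconv m H ⊆
      tconv m (fun i (jk : Fin n × Fin p) => A i jk.1 + H i jk.2) := by
  have : Nonempty (Fin n) := ⟨⟨0, hn⟩⟩
  have : Nonempty (Fin p) := ⟨⟨0, hp⟩⟩
  rintro _ ⟨y, ⟨α, hα⟩, z, ⟨β, hβ⟩, rfl⟩
  refine ⟨fun jk => α jk.1 + β jk.2, fun k => ?_⟩
  simp only [Pi.add_apply, hα k, hβ k, add_add_add_comm (α _) (β _)]
  rw [ciInf_prod_add (fun j => α j + A _ j) (fun j => β j + H _ j),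
    ciInf_prod_add (fun j => α j + A _ j) (fun j => β j + H _ j)]
  ring
end
end

section
/- Let m ≥ 2, let R > 0 and 0 < ε ≤ R be reals, and let 0 ≤ d ≤ m−1 be an integer. Suppose K ⊆ ℝ^{m−1} is contained in v + θ(C), where v ∈ ℝ^{m−1}, θ is a linear isometry of ℝ^{m−1}, and C = [−R√(m−1), R√(m−1)]^d × {0}^{m−1−d}. Then the Lebesgue measure of the Minkowski sum K + B_H(ε) is at most (4R√(m−1))^d · (2ε)^{m−1−d}. -/
open MeasureTheory Pointwise
noncomputable section

/-- Adding a segment parallel to a coordinate axis to a compact convex set increases the volume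
by at most the length of the segment times the volume of the projection along that axis. -/
theorem volume_add_axis_le {k : ℕ} (j : Fin (k + 1)) {S : Set (Fin (k + 1) → ℝ)}
    (hS : IsCompact S) (hconv : Convex ℝ S) {a b : ℝ} (hab : a ≤ b) :
    volume (S + (fun t : ℝ => (Pi.single j t : Fin (k + 1) → ℝ)) '' Set.Icc a b) ≤
      volume S + ENNReal.ofReal (b - a) *
        volume (LinearMap.funLeft ℝ ℝ j.succAbove '' S) := by
  set T : Set (Fin (k + 1) → ℝ) :=
    (fun t : ℝ => (Pi.single j t : Fin (k + 1) → ℝ)) '' Set.Icc a b with hT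
  set P : Set (Fin k → ℝ) := LinearMap.funLeft ℝ ℝ j.succAbove '' S with hP
  have hcont : Continuous (fun p : ℝ × (Fin k → ℝ) => (j.insertNth p.1 p.2 : Fin (k + 1) → ℝ)) := by
    fun_prop
  have hsingle : Continuous (fun t : ℝ => (Pi.single j t : Fin (k + 1) → ℝ)) :=
    continuous_single (A := fun _ => ℝ) j
  have hTc : IsCompact T := isCompact_Icc.image hsingle
  have hPc : IsCompact P := hS.image (LinearMap.continuous_of_finiteDimensional _)
  have fubini : ∀ X : Set (Fin (k + 1) → ℝ), IsCompact X → volume X =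
      ∫⁻ x : Fin k → ℝ, volume {t : ℝ | (j.insertNth t x : Fin (k + 1) → ℝ) ∈ X} := by
    intro X hX
    have h1 := (volume_preserving_piFinSuccAbove (fun _ : Fin (k + 1) => ℝ) j).symm
    rw [← h1.measure_preimage hX.measurableSet.nullMeasurableSet, Measure.volume_eq_prod,
      Measure.prod_apply_symm (h1.measurable hX.measurableSet)]
    rfl
  have fiber : ∀ x : Fin k → ℝ,
      volume {t : ℝ | (j.insertNth t x : Fin (k + 1) → ℝ) ∈ S + T} ≤
        volume {t : ℝ | (j.insertNth t x : Fin (k + 1) → ℝ) ∈ S} +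
          P.indicator (fun _ => ENNReal.ofReal (b - a)) x := by
    intro x
    set F : Set ℝ := {t : ℝ | (j.insertNth t x : Fin (k + 1) → ℝ) ∈ S} with hF
    have hsub : {t : ℝ | (j.insertNth t x : Fin (k + 1) → ℝ) ∈ S + T} ⊆ F + Set.Icc a b := by
      rintro t ⟨s, hs, _, ⟨u, hu, rfl⟩, hst⟩
      refine ⟨t - u, ?_, u, hu, by simp⟩
      have : (j.insertNth (t - u) x : Fin (k + 1) → ℝ) = s := by
        have : s = (j.insertNth t x : Fin (k + 1) → ℝ) - Pi.single j u := by
          rw [← hst]; simp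
        rw [this]
        ext i
        refine Fin.succAboveCases j ?_ (fun i => ?_) i <;> simp
      simpa [hF, this] using hs
    refine (measure_mono hsub).trans ?_
    rcases F.eq_empty_or_nonempty with hE | hne
    · simp [hE]
    have hx : x ∈ P := by
      obtain ⟨t, ht⟩ := hne
      refine ⟨_, ht, ?_⟩
      ext i
      simp [LinearMap.funLeft_apply]
    have hcl : IsClosed F := hS.isClosed.preimage (hcont.comp (by fun_prop : Continuous fun t : ℝ => (t, x)))
    have hFc : IsCompact F := by
      refine (hS.image (continuous_apply j)).of_isClosed_subset hcl ?_
      intro t ht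
      exact ⟨_, ht, by simp⟩
    have hFconv : Convex ℝ F := by
      intro t ht u hu α β hα hβ hαβ
      have := hconv ht hu hα hβ hαβ
      rw [hF, Set.mem_ofPred_eq]
      convert this using 1
      ext i
      refine Fin.succAboveCases j ?_ (fun i => ?_) i
      · simp
      · simp [← add_mul, hαβ]
    have hI := eq_Icc_of_connected_compact ⟨hne, hFconv.isPreconnected⟩ hFc
    have hle : sInf F ≤ sSup F := Real.sInf_le_sSup F hFc.bddBelow hFc.bddAbove
    rw [hI, Set.indicator_of_mem hx]
    refine (measure_mono (Set.Icc_add_Icc_subset _ _ _ _)).trans ?_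
    rw [Real.volume_Icc, Real.volume_Icc, ← ENNReal.ofReal_add (by linarith) (by linarith)]
    exact ENNReal.ofReal_le_ofReal (by linarith)
  rw [fubini _ (hS.add hTc)]
  refine (lintegral_mono fiber).trans ?_
  rw [lintegral_add_right _ (measurable_const.indicator hPc.measurableSet),
    lintegral_indicator_const hPc.measurableSet, ← fubini S hS]

/-- The zonotope generated by a list of vectors. -/
def zonotope {k : ℕ} : List (Fin k → ℝ) → Set (Fin k → ℝ)
  | [] => {0}
  | g :: l => segment ℝ 0 g + zonotope l

/-- The sum of the rank one matrices `g gᵀ` over a list of vectors `g`. -/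
def frameMatrix {k : ℕ} : List (Fin k → ℝ) → Matrix (Fin k) (Fin k) ℝ
  | [] => 0
  | g :: l => Matrix.vecMulVec g g + frameMatrix l

theorem isCompact_segment_pi {k : ℕ} (x y : Fin k → ℝ) : IsCompact (segment ℝ x y) := by
  rw [segment_eq_image ℝ x y]
  exact isCompact_Icc.image (by fun_prop)

theorem isCompact_zonotope {k : ℕ} (l : List (Fin k → ℝ)) : IsCompact (zonotope l) := by
  induction l with
  | nil => exact isCompact_singleton
  | cons g l ih => exact (isCompact_segment_pi _ _).add ih

theorem convex_zonotope {k : ℕ} (l : List (Fin k → ℝ)) : Convex ℝ (zonotope l) := by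
  induction l with
  | nil => exact convex_singleton _
  | cons g l ih => exact (convex_segment _ _).add ih

theorem image_zonotope {k n : ℕ} (f : (Fin n → ℝ) →ₗ[ℝ] (Fin k → ℝ)) (l : List (Fin n → ℝ)) :
    f '' zonotope l = zonotope (l.map f) := by
  induction l with
  | nil => simp [zonotope]
  | cons g l ih =>
    have := image_segment ℝ f.toAffineMap 0 g
    simp only [LinearMap.coe_toAffineMap, map_zero] at this
    rw [zonotope, Set.image_add, ih, this]
    rfl

theorem frameMatrix_map {k n : ℕ} (A : Matrix (Fin k) (Fin n) ℝ) (l : List (Fin n → ℝ)) :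
    frameMatrix (l.map A.mulVecLin) = A * frameMatrix l * A.transpose := by
  induction l with
  | nil => simp [frameMatrix]
  | cons g l ih =>
    simp only [List.map_cons, frameMatrix, ih, Matrix.mul_add, Matrix.add_mul,
      Matrix.mulVecLin_apply, Matrix.mul_vecMulVec, Matrix.vecMulVec_mul, Matrix.vecMul_transpose]

theorem frameMatrix_map_succ {k : ℕ} (l : List (Fin (k + 1) → ℝ)) :
    frameMatrix (l.map (LinearMap.funLeft ℝ ℝ (Fin.succAbove 0))) =
      (frameMatrix l).submatrix (Fin.succAbove 0) (Fin.succAbove 0) := by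
  induction l with
  | nil => rfl
  | cons g l ih =>
    rw [List.map_cons, frameMatrix, ih]
    rfl

theorem det_frameMatrix_nonneg {k : ℕ} (l : List (Fin k → ℝ)) : 0 ≤ (frameMatrix l).det := by
  have : (frameMatrix l).PosSemidef := by
    induction l with
    | nil => exact Matrix.PosSemidef.zero
    | cons g l ih => exact (Matrix.posSemidef_vecMulVec_self_star g).add ih
  exact this.det_nonneg

theorem det_single_add {k : ℕ} (M : Matrix (Fin (k + 1)) (Fin (k + 1)) ℝ) :
    (Matrix.vecMulVec (Pi.single 0 1) (Pi.single 0 1) + M).det =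
      M.det + (M.submatrix (Fin.succAbove 0) (Fin.succAbove 0)).det := by
  have h : ∀ j : Fin k, (Matrix.vecMulVec (Pi.single 0 1) (Pi.single 0 1) + M).submatrix Fin.succ
      (Fin.succAbove j.succ) = M.submatrix Fin.succ (Fin.succAbove j.succ) := by
    intro j; ext a b
    simp [Matrix.vecMulVec_apply]
  have h0 : (Matrix.vecMulVec (Pi.single 0 1) (Pi.single 0 1) + M).submatrix Fin.succ
      (Fin.succAbove 0) = M.submatrix Fin.succ (Fin.succAbove 0) := by
    ext a b
    simp [Matrix.vecMulVec_apply]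
  rw [Matrix.det_succ_row_zero, Matrix.det_succ_row_zero M, Fin.sum_univ_succ, Fin.sum_univ_succ]
  simp only [h, h0]
  simp [Matrix.vecMulVec_apply]
  ring

theorem sqrt_mul_add_sqrt_mul_le {a b x y : ℝ} (ha : 0 ≤ a) (hb : 0 ≤ b) (hx : 0 ≤ x)
    (hy : 0 ≤ y) : √(a * x) + √(b * y) ≤ √((a + b) * (x + y)) := by
  apply Real.le_sqrt_of_sq_le
  rw [Real.sqrt_mul ha, Real.sqrt_mul hb]
  have h1 := Real.sq_sqrt ha
  have h2 := Real.sq_sqrt hb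
  have h3 := Real.sq_sqrt hx
  have h4 := Real.sq_sqrt hy
  have := sq_nonneg (√a * √y - √b * √x)
  calc _ = √a ^ 2 * √x ^ 2 + √b ^ 2 * √y ^ 2 + 2 * (√a * √y) * (√b * √x) := by ring
    _ ≤ √a ^ 2 * √x ^ 2 + √b ^ 2 * √y ^ 2 + (√a ^ 2 * √y ^ 2 + √b ^ 2 * √x ^ 2) := by nlinarith
    _ = _ := by rw [h1, h2, h3, h4]; ring

theorem exists_det_ne_zero_mulVec_eq_single {k : ℕ} {g : Fin (k + 1) → ℝ} (hg : g ≠ 0) :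
    ∃ A : Matrix (Fin (k + 1)) (Fin (k + 1)) ℝ, A.det ≠ 0 ∧ A.mulVec g = Pi.single 0 1 := by
  have h1 : (Pi.single 0 1 : Fin (k + 1) → ℝ) ≠ 0 := by simp
  obtain ⟨e, he⟩ := SeparatingDual.exists_continuousLinearEquiv_apply_eq (R := ℝ) hg h1
  refine ⟨LinearMap.toMatrix' (e.toLinearEquiv : (Fin (k + 1) → ℝ) →ₗ[ℝ] (Fin (k + 1) → ℝ)), ?_, ?_⟩
  · rw [LinearMap.det_toMatrix']
    exact (LinearEquiv.isUnit_det' e.toLinearEquiv).ne_zero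
  · rw [← Matrix.toLin'_apply, Matrix.toLin'_toMatrix']
    exact he

/-- The volume of a zonotope with `N` generators in `ℝᵏ` is at most the square root of
`N.choose k` times the determinant of its frame matrix. -/
theorem volume_zonotope_le {k : ℕ} (l : List (Fin k → ℝ)) :
    volume (zonotope l) ≤ ENNReal.ofReal √(l.length.choose k * (frameMatrix l).det) := by
  suffices H : ∀ (N k : ℕ) (l : List (Fin k → ℝ)), l.length = N →
      volume (zonotope l) ≤ ENNReal.ofReal √(l.length.choose k * (frameMatrix l).det) from
    H _ _ l rfl
  intro N
  induction N with
  | zero =>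
    intro k l hl
    obtain rfl := List.length_eq_zero_iff.1 hl
    cases k with
    | zero =>
      refine (measure_mono (Set.subset_univ _)).trans ?_
      simp [volume_pi]
    | succ k => simp [zonotope]
  | succ N ih =>
    intro k l hl
    obtain ⟨g, l, rfl⟩ := List.exists_cons_of_length_eq_add_one hl
    simp only [List.length_cons, Nat.add_right_cancel_iff] at hl
    cases k with
    | zero =>
      refine (measure_mono (Set.subset_univ _)).trans ?_
      simp [volume_pi]
    | succ k =>
      by_cases hg : g = 0
      · subst hg
        have : zonotope ((0 : Fin (k + 1) → ℝ) :: l) = zonotope l := by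
          simp [zonotope]
        rw [this]
        refine (ih _ l hl).trans (ENNReal.ofReal_le_ofReal (Real.sqrt_le_sqrt ?_))
        have h0 : frameMatrix ((0 : Fin (k + 1) → ℝ) :: l) = frameMatrix l := by
          simp [frameMatrix]
        rw [h0]
        refine mul_le_mul_of_nonneg_right ?_ (det_frameMatrix_nonneg l)
        exact_mod_cast Nat.choose_le_choose _ (by simp)
      · obtain ⟨A, hA, hAg⟩ := exists_det_ne_zero_mulVec_eq_single hg
        set l' := l.map A.mulVecLin with hl'
        have hlen : l'.length = N := by simp [hl', hl]
        have key : volume (zonotope (Pi.single 0 1 :: l')) ≤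
            ENNReal.ofReal √((N + 1).choose (k + 1) * (frameMatrix (Pi.single 0 1 :: l')).det) := by
          have hseg : segment ℝ (0 : Fin (k + 1) → ℝ) (Pi.single 0 1) =
              (fun t : ℝ => (Pi.single 0 t : Fin (k + 1) → ℝ)) '' Set.Icc 0 1 := by
            rw [segment_eq_image]
            refine Set.image_congr fun t _ => ?_
            ext i
            by_cases hi : i = 0
            · subst hi; simp
            · simp [hi]
          rw [zonotope, add_comm (segment ℝ _ _), hseg]
          refine (volume_add_axis_le 0 (isCompact_zonotope l') (convex_zonotope l')
            zero_le_one).trans ?_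
          rw [image_zonotope]
          have i1 := ih _ l' hlen
          have i2 := ih _ (l'.map (LinearMap.funLeft ℝ ℝ (Fin.succAbove 0))) (by simp [hlen])
          rw [frameMatrix_map_succ] at i2
          have hn := det_frameMatrix_nonneg (l'.map (LinearMap.funLeft ℝ ℝ (Fin.succAbove 0)))
          rw [frameMatrix_map_succ] at hn
          simp only [List.length_map, hlen] at i1 i2
          rw [frameMatrix, det_single_add, sub_zero, ENNReal.ofReal_one, one_mul]
          refine (add_le_add i1 i2).trans ?_
          rw [← ENNReal.ofReal_add (Real.sqrt_nonneg _) (Real.sqrt_nonneg _)]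
          refine ENNReal.ofReal_le_ofReal ((sqrt_mul_add_sqrt_mul_le (by positivity)
            (by positivity) (det_frameMatrix_nonneg l') hn).trans (le_of_eq ?_))
          rw [Nat.choose_succ_succ', Nat.cast_add, add_comm (N.choose k : ℝ)]
        have hmap : (Pi.single 0 1 : Fin (k + 1) → ℝ) :: l' = (g :: l).map A.mulVecLin := by
          simp [hl', hAg]
        rw [hmap, ← image_zonotope, frameMatrix_map, Matrix.det_mul, Matrix.det_mul,
          Matrix.det_transpose, Measure.addHaar_image_linearMap] at key
        have hdet : LinearMap.det A.mulVecLin = A.det := by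
          rw [← Matrix.toLin'_apply', LinearMap.det_toLin']
        have hs : √((N + 1).choose (k + 1) * (A.det * (frameMatrix (g :: l)).det * A.det)) =
            |A.det| * √((N + 1).choose (k + 1) * (frameMatrix (g :: l)).det) := by
          rw [← Real.sqrt_sq_eq_abs, ← Real.sqrt_mul (sq_nonneg _)]
          ring_nf
        rw [hdet, hs, ENNReal.ofReal_mul (abs_nonneg _)] at key
        simp only [List.length_cons, hl]
        exact (ENNReal.mul_le_mul_iff_right (by simpa using hA) ENNReal.ofReal_ne_top).1 key

theorem mem_zonotope_ofFn {k N : ℕ} (g : Fin N → Fin k → ℝ) (y : Fin k → ℝ) :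
    y ∈ zonotope (List.ofFn g) ↔
      ∃ t : Fin N → ℝ, (∀ i, t i ∈ Set.Icc (0 : ℝ) 1) ∧ ∑ i, t i • g i = y := by
  induction N generalizing y with
  | zero => simp [zonotope, eq_comm]
  | succ N ih =>
    rw [List.ofFn_succ, zonotope, Set.mem_add]
    simp only [ih, segment_eq_image, Set.mem_image]
    constructor
    · rintro ⟨_, ⟨u, hu, rfl⟩, _, ⟨t, ht, rfl⟩, rfl⟩
      refine ⟨Fin.cons u t, fun i => ?_, by simp [Fin.sum_univ_succ]⟩
      refine Fin.cases ?_ (fun i => ?_) i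
      · simpa using hu
      · simpa using ht i
    · rintro ⟨t, ht, rfl⟩
      exact ⟨_, ⟨t 0, ht 0, rfl⟩, _, ⟨_, fun i => ht i.succ, rfl⟩, by simp [Fin.sum_univ_succ]⟩

theorem frameMatrix_ofFn {k N : ℕ} (g : Fin N → Fin k → ℝ) :
    frameMatrix (List.ofFn g) = ∑ i, Matrix.vecMulVec (g i) (g i) := by
  induction N with
  | zero => simp [frameMatrix]
  | succ N ih => rw [List.ofFn_succ, frameMatrix, ih, Fin.sum_univ_succ]

/-- Generators of the Hilbert ball of radius `δ` as a zonotope. -/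
def hilbertGenerators (n : ℕ) (δ : ℝ) : List (Fin n → ℝ) :=
  (fun _ => -δ) :: List.ofFn fun i => Pi.single i δ

theorem mem_zonotope_hilbertGenerators {n : ℕ} {δ : ℝ} (y : Fin n → ℝ) :
    y ∈ zonotope (hilbertGenerators n δ) ↔
      ∃ u ∈ Set.Icc (0 : ℝ) 1, ∃ t : Fin n → ℝ, (∀ i, t i ∈ Set.Icc (0 : ℝ) 1) ∧
        ∀ i, y i = δ * (t i - u) := by
  rw [hilbertGenerators, zonotope, Set.mem_add]
  simp only [mem_zonotope_ofFn, segment_eq_image, Set.mem_image]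
  have hsum : ∀ t : Fin n → ℝ, ∑ i, t i • (Pi.single i δ : Fin n → ℝ) = fun i => t i * δ := by
    intro t
    ext i
    simp [Finset.sum_apply, Pi.single_apply]
  constructor
  · rintro ⟨_, ⟨u, hu, rfl⟩, _, ⟨t, ht, rfl⟩, rfl⟩
    refine ⟨u, hu, t, ht, fun i => ?_⟩
    rw [hsum]
    simp
    ring
  · rintro ⟨u, hu, t, ht, h⟩
    refine ⟨_, ⟨u, hu, rfl⟩, _, ⟨t, ht, rfl⟩, ?_⟩
    ext i
    rw [hsum, h]
    simp
    ring

theorem hilbertBall_subset_zonotope {n : ℕ} {δ : ℝ} (hδ : 0 < δ) :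
    hilbertBall n δ ⊆ zonotope (hilbertGenerators n δ) := by
  intro y hy
  rw [hilbertBall, Set.mem_ofPred_eq] at hy
  rw [mem_zonotope_hilbertGenerators]
  have hsup : ∀ i, y i ≤ ⨆ i, y i := fun i => le_ciSup (Set.finite_range y).bddAbove i
  have hinf : ∀ i, ⨅ i, y i ≤ y i := fun i => ciInf_le (Set.finite_range y).bddBelow i
  set a := max 0 (⨆ i, y i)
  set b := min 0 (⨅ i, y i)
  have ha : 0 ≤ a := le_max_left _ _
  have hb : b ≤ 0 := min_le_left _ _
  have ha' : ∀ i, y i ≤ a := fun i => (hsup i).trans (le_max_right _ _)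
  have hb' : ∀ i, b ≤ y i := fun i => (min_le_right _ _).trans (hinf i)
  refine ⟨-b / δ, ⟨div_nonneg (by linarith) hδ.le, (div_le_one hδ).2 (by linarith)⟩,
    fun i => (y i - b) / δ, fun i => ⟨div_nonneg (by linarith [hb' i]) hδ.le,
      (div_le_one hδ).2 (by linarith [ha' i])⟩, fun i => ?_⟩
  field_simp
  ring

theorem abs_le_of_mem_zonotope_hilbertGenerators {n : ℕ} {δ : ℝ} (hδ : 0 < δ) {y : Fin n → ℝ}
    (hy : y ∈ zonotope (hilbertGenerators n δ)) (i : Fin n) : |y i| ≤ δ := by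
  obtain ⟨u, ⟨hu0, hu1⟩, t, ht, h⟩ := (mem_zonotope_hilbertGenerators y).1 hy
  rw [h i, abs_le]
  obtain ⟨h0, h1⟩ := ht i
  constructor <;> nlinarith

theorem frameMatrix_hilbertGenerators (n : ℕ) (δ : ℝ) :
    frameMatrix (hilbertGenerators n δ) =
      δ ^ 2 • (1 + Matrix.vecMulVec (fun _ => 1) (fun _ => 1)) := by
  rw [hilbertGenerators, frameMatrix, frameMatrix_ofFn]
  ext i j
  by_cases hij : i = j
  · subst hij
    simp [Matrix.vecMulVec_apply, Matrix.sum_apply, Pi.single_apply]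
    ring
  · simp [Matrix.vecMulVec_apply, Matrix.sum_apply, Pi.single_apply, hij]
    ring

theorem dotProduct_mulVec_self_le {k n : ℕ} {M : Matrix (Fin k) (Fin n) ℝ}
    (hM : M * M.transpose = 1) (x : Fin n → ℝ) :
    M.mulVec x ⬝ᵥ M.mulVec x ≤ x ⬝ᵥ x := by
  set p := M.transpose.mulVec (M.mulVec x) with hp
  have h1 : x ⬝ᵥ p = M.mulVec x ⬝ᵥ M.mulVec x := by
    rw [hp, Matrix.dotProduct_mulVec, Matrix.vecMul_transpose]
  have h2 : p ⬝ᵥ p = M.mulVec x ⬝ᵥ M.mulVec x := by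
    rw [hp, Matrix.dotProduct_mulVec, Matrix.vecMul_transpose, Matrix.mulVec_mulVec, hM,
      Matrix.one_mulVec]
  have h3 : 0 ≤ (x - p) ⬝ᵥ (x - p) := by
    simp only [dotProduct]
    exact Finset.sum_nonneg fun i _ => mul_self_nonneg _
  rw [sub_dotProduct, dotProduct_sub, dotProduct_sub, dotProduct_comm p x, h1, h2] at h3
  linarith

theorem abs_mulVec_le {k n : ℕ} {M : Matrix (Fin k) (Fin n) ℝ} (hM : M * M.transpose = 1)
    {δ : ℝ} (hδ : 0 ≤ δ) {y : Fin n → ℝ} (hy : ∀ i, |y i| ≤ δ) (i : Fin k) :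
    |M.mulVec y i| ≤ √n * δ := by
  apply abs_le_of_sq_le_sq _ (by positivity)
  rw [mul_pow, Real.sq_sqrt (Nat.cast_nonneg n)]
  calc M.mulVec y i ^ 2 ≤ M.mulVec y ⬝ᵥ M.mulVec y := by
        rw [sq]
        exact Finset.single_le_sum (f := fun i => M.mulVec y i * M.mulVec y i)
          (fun j _ => mul_self_nonneg _) (Finset.mem_univ i)
    _ ≤ y ⬝ᵥ y := dotProduct_mulVec_self_le hM y
    _ ≤ ∑ _i : Fin n, δ ^ 2 := by
        refine Finset.sum_le_sum fun j _ => ?_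
        rw [← sq]
        exact sq_le_sq.2 ((hy j).trans (le_abs_self δ))
    _ = n * δ ^ 2 := by simp

/-- Volume bound for the orthogonal projections of the Hilbert ball. -/
theorem volume_image_zonotope_hilbertGenerators_le {k n : ℕ} {M : Matrix (Fin k) (Fin n) ℝ}
    (hM : M * M.transpose = 1) {δ : ℝ} (hδ : 0 < δ) :
    volume (M.mulVecLin '' zonotope (hilbertGenerators n δ)) ≤
      ENNReal.ofReal (δ ^ k * √((n + 1) * (n + 1).choose k)) := by
  rw [image_zonotope]
  refine (volume_zonotope_le _).trans (ENNReal.ofReal_le_ofReal ?_)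
  set u : Fin k → ℝ := M.mulVec (fun _ => 1) with hu
  have hdet : (M * frameMatrix (hilbertGenerators n δ) * M.transpose).det =
      (δ ^ 2) ^ k * (1 + u ⬝ᵥ u) := by
    rw [frameMatrix_hilbertGenerators, Matrix.mul_smul, Matrix.smul_mul, Matrix.mul_add,
      Matrix.add_mul, Matrix.mul_one, hM, Matrix.mul_vecMulVec, Matrix.vecMulVec_mul,
      Matrix.vecMul_transpose, Matrix.det_smul, ← hu, Matrix.vecMulVec_eq Unit,
      Matrix.det_one_add_replicateCol_mul_replicateRow, Fintype.card_fin]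
  have hle : u ⬝ᵥ u ≤ n := by
    simpa [dotProduct] using dotProduct_mulVec_self_le hM (fun _ => 1)
  rw [frameMatrix_map, hdet, List.length_map]
  have hlen : (hilbertGenerators n δ).length = n + 1 := by simp [hilbertGenerators]
  rw [hlen]
  apply Real.sqrt_le_iff.2 ⟨by positivity, ?_⟩
  rw [mul_pow, Real.sq_sqrt (by positivity), ← pow_mul, ← pow_mul, mul_comm k 2]
  have : 0 ≤ ((n + 1).choose k : ℝ) * δ ^ (2 * k) := by positivity
  nlinarith

/-- The cube `[-s, s]ᵈ × {0}ᵏ⁻ᵈ`. -/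
def flatCube (k d : ℕ) (s : ℝ) : Set (Fin k → ℝ) :=
  Set.pi Set.univ fun i => if (i : ℕ) < d then Set.Icc (-s) s else {0}

theorem mem_flatCube {k d : ℕ} {s : ℝ} {y : Fin k → ℝ} :
    y ∈ flatCube k d s ↔ ∀ i : Fin k, ((i : ℕ) < d → |y i| ≤ s) ∧ (d ≤ (i : ℕ) → y i = 0) := by
  rw [flatCube, Set.mem_univ_pi]
  refine forall_congr' fun i => ?_
  by_cases h : (i : ℕ) < d
  · simp [h, abs_le, Nat.not_le.2 h]
  · simp [h, Nat.not_lt.1 h]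

theorem isCompact_flatCube (k d : ℕ) (s : ℝ) : IsCompact (flatCube k d s) := by
  refine isCompact_univ_pi fun i => ?_
  split_ifs
  exacts [isCompact_Icc, isCompact_singleton]

theorem convex_flatCube (k d : ℕ) (s : ℝ) : Convex ℝ (flatCube k d s) := by
  refine convex_pi fun i _ => ?_
  split_ifs
  exacts [convex_Icc _ _, convex_singleton _]

theorem flatCube_zero (k : ℕ) (s : ℝ) : flatCube k 0 s = 0 := by
  ext y
  simp [mem_flatCube, funext_iff]

theorem flatCube_succ_subset {k : ℕ} (j : Fin (k + 1)) (s : ℝ) :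
    flatCube (k + 1) (j + 1) s ⊆ flatCube (k + 1) j s +
      (fun t : ℝ => (Pi.single j t : Fin (k + 1) → ℝ)) '' Set.Icc (-s) s := by
  intro y hy
  rw [mem_flatCube] at hy
  refine ⟨y - Pi.single j (y j), mem_flatCube.2 fun i => ?_, _,
    ⟨y j, abs_le.1 ((hy j).1 (Nat.lt_succ_self _)), rfl⟩, by simp⟩
  by_cases hij : i = j
  · subst hij; simp
  · have hij' : (i : ℕ) ≠ j := fun h => hij (Fin.ext h)
    simp only [Pi.sub_apply, Pi.single_apply, hij, if_false, sub_zero]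
    exact ⟨fun h => (hy i).1 (by omega), fun h => (hy i).2 (by omega)⟩

theorem image_flatCube_subset {k : ℕ} (j : Fin (k + 1)) (s : ℝ) :
    LinearMap.funLeft ℝ ℝ j.succAbove '' flatCube (k + 1) j s ⊆ flatCube k j s := by
  rintro _ ⟨y, hy, rfl⟩
  rw [mem_flatCube] at hy ⊢
  intro i
  rw [LinearMap.funLeft_apply]
  refine ⟨fun h => (hy _).1 ?_, fun h => (hy _).2 ?_⟩
  · rw [Fin.succAbove_of_castSucc_lt _ _ (by simpa [Fin.lt_def] using h)]
    simpa using h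
  · rw [Fin.succAbove_of_le_castSucc _ _ (by simpa [Fin.le_def] using h)]
    simp; omega

/-- Bound for the volume of a `k`-dimensional convex body plus a `d`-dimensional cube of side
`2 * s`, where `V` bounds the volumes of the projections of the body. -/
def sweepBound (s : ℝ) (V : ℕ → ℝ) : ℕ → ℕ → ℝ
  | k, 0 => V k
  | k, d + 1 => sweepBound s V k d + 2 * s * sweepBound s V (k - 1) d

theorem sweepBound_nonneg {s : ℝ} (hs : 0 ≤ s) {V : ℕ → ℝ} (hV : ∀ k, 0 ≤ V k) (k d : ℕ) :
    0 ≤ sweepBound s V k d := by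
  induction d generalizing k with
  | zero => exact hV k
  | succ d ih =>
    have := ih k
    have := ih (k - 1)
    rw [sweepBound]
    positivity

theorem volume_image_add_flatCube_le {n : ℕ} {B : Set (Fin n → ℝ)} (hB : IsCompact B)
    (hBc : Convex ℝ B) {s : ℝ} (hs : 0 ≤ s) {V : ℕ → ℝ} (hV0 : ∀ k, 0 ≤ V k)
    (hV : ∀ (k : ℕ) (M : Matrix (Fin k) (Fin n) ℝ), M * M.transpose = 1 →
      volume (M.mulVecLin '' B) ≤ ENNReal.ofReal (V k))
    {k d : ℕ} (hd : d ≤ k) {M : Matrix (Fin k) (Fin n) ℝ} (hM : M * M.transpose = 1) :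
    volume (M.mulVecLin '' B + flatCube k d s) ≤ ENNReal.ofReal (sweepBound s V k d) := by
  induction d generalizing k with
  | zero => simpa [flatCube_zero, sweepBound] using hV k M hM
  | succ d ih =>
    obtain ⟨k, rfl⟩ : ∃ l, k = l + 1 := ⟨k - 1, by omega⟩
    obtain ⟨j, rfl⟩ : ∃ j : Fin (k + 1), (j : ℕ) = d := ⟨⟨d, by omega⟩, rfl⟩
    set S := M.mulVecLin '' B + flatCube (k + 1) j s with hS
    have hSc : IsCompact S :=
      (hB.image (LinearMap.continuous_of_finiteDimensional _)).add (isCompact_flatCube _ _ _)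
    have hSconv : Convex ℝ S := (hBc.linear_image _).add (convex_flatCube _ _ _)
    have hsub : M.mulVecLin '' B + flatCube (k + 1) (j + 1) s ⊆
        S + (fun t : ℝ => (Pi.single j t : Fin (k + 1) → ℝ)) '' Set.Icc (-s) s := by
      rw [hS, add_assoc]
      exact Set.add_subset_add_left (flatCube_succ_subset j s)
    set M' : Matrix (Fin k) (Fin n) ℝ := M.submatrix j.succAbove id with hM'
    have hM'1 : M' * M'.transpose = 1 := by
      rw [hM', Matrix.transpose_submatrix, ← Matrix.submatrix_mul _ _ _ _ _ Function.bijective_id,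
        hM, Matrix.submatrix_one _ Fin.succAbove_right_injective]
    have himg : LinearMap.funLeft ℝ ℝ j.succAbove '' S ⊆ M'.mulVecLin '' B + flatCube k j s := by
      rw [hS, Set.image_add, Set.image_image]
      exact Set.add_subset_add subset_rfl (image_flatCube_subset j s)
    refine (measure_mono hsub).trans ((volume_add_axis_le j hSc hSconv (by linarith)).trans ?_)
    rw [sweepBound, ENNReal.ofReal_add (sweepBound_nonneg hs hV0 _ _)
      (mul_nonneg (by positivity) (sweepBound_nonneg hs hV0 _ _)),
      ENNReal.ofReal_mul (by positivity)]
    refine add_le_add (ih (by omega) hM) ?_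
    rw [show s - -s = 2 * s by ring]
    gcongr
    exact (measure_mono himg).trans (ih (by omega) hM'1)

theorem sweepBound_le {s ε C : ℝ} (hs : 0 ≤ s) {V : ℕ → ℝ}
    (hV : ∀ k, V k ≤ C * ε ^ k) {k d : ℕ} (hd : d ≤ k) :
    sweepBound s V k d ≤ C * ε ^ (k - d) * (ε + 2 * s) ^ d := by
  induction d generalizing k with
  | zero => simpa [sweepBound] using hV k
  | succ d ih =>
    have h1 := ih (k := k) (by omega)
    have h2 := mul_le_mul_of_nonneg_left (ih (k := k - 1) (by omega))
      (by positivity : 0 ≤ 2 * s)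
    rw [sweepBound]
    refine (add_le_add h1 h2).trans (le_of_eq ?_)
    rw [show k - d = (k - (d + 1)) + 1 by omega, show k - 1 - d = k - (d + 1) by omega]
    ring

theorem mul_pow_sweep_le {n d : ℕ} (hd : d ≤ n) {C r R ε b : ℝ} (hC : 0 ≤ C) (hr : 0 < r)
    (hε : 0 < ε) (hεR : ε ≤ R) (hb : 1 + 2 * r ≤ b * (2 * r))
    (hCb : C ^ 2 * b ^ (2 * d) ≤ 4 ^ n) :
    C * ε ^ (n - d) * (ε + 2 * (R * r)) ^ d ≤ (4 * R * r) ^ d * (2 * ε) ^ (n - d) := by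
  have hR : 0 < R := hε.trans_le hεR
  have h1 : C * b ^ d ≤ 2 ^ n := by
    apply le_of_sq_le_sq _ (by positivity)
    calc _ = C ^ 2 * b ^ (2 * d) := by ring
      _ ≤ 4 ^ n := hCb
      _ = _ := by rw [← pow_mul, mul_comm n 2, pow_mul]; norm_num
  have h2 : ε + 2 * (R * r) ≤ R * (b * (2 * r)) := by nlinarith
  have h3 : (2 : ℝ) ^ n = 2 ^ d * 2 ^ (n - d) := by rw [← pow_add, Nat.add_sub_cancel' hd]
  calc C * ε ^ (n - d) * (ε + 2 * (R * r)) ^ d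
      ≤ C * ε ^ (n - d) * (R * (b * (2 * r))) ^ d := by gcongr
    _ = C * b ^ d * (ε ^ (n - d) * (2 * (R * r)) ^ d) := by
        rw [show R * (b * (2 * r)) = b * (2 * (R * r)) by ring, mul_pow b]
        ring
    _ ≤ 2 ^ n * (ε ^ (n - d) * (2 * (R * r)) ^ d) := by gcongr
    _ = (4 * R * r) ^ d * (2 * ε) ^ (n - d) := by
        rw [h3, show 4 * R * r = 2 * (2 * (R * r)) by ring, mul_pow 2 (2 * (R * r)), mul_pow 2 ε]
        ring

theorem choose_succ_le_two_pow (n k : ℕ) : (n + 1).choose k ≤ 2 ^ n := by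
  induction n generalizing k with
  | zero => rcases k with _ | _ | k <;> simp [Nat.choose_eq_zero_of_lt]
  | succ n ih =>
    cases k with
    | zero => simpa using Nat.one_le_two_pow
    | succ k =>
      rw [Nat.choose_succ_succ, pow_succ]
      linarith [ih k, ih (k + 1)]

theorem succ_sq_le_two_pow {n : ℕ} (hn : 6 ≤ n) : (n + 1) ^ 2 ≤ 2 ^ n := by
  induction n, hn using Nat.le_induction with
  | base => norm_num
  | succ n hn ih => rw [pow_succ 2]; nlinarith

theorem le_mul_two_sqrt {a x : ℝ} (ha : 0 < a) (hx : 1 ≤ 4 * a ^ 2 * x) :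
    1 + 2 * √x ≤ (1 + a) * (2 * √x) := by
  have h : 1 / (2 * a) ≤ √x := by
    apply Real.le_sqrt_of_sq_le
    rw [div_pow, div_le_iff₀ (by positivity)]
    linarith
  rw [div_le_iff₀ (by positivity)] at h
  linarith

section

variable {n d : ℕ} {R ε : ℝ} {M : Matrix (Fin n) (Fin n) ℝ}

theorem volume_image_hilbertGenerators_add_flatCube_le_of_choose_le (hn : 0 < n)
    (hd : d ≤ n) (hε : 0 < ε) (hεR : ε ≤ R) (hM : M * M.transpose = 1) {c : ℕ} {a : ℝ}
    (hc : ∀ k, (n + 1).choose k ≤ c) (ha : 0 < a) (han : 1 ≤ 4 * a ^ 2 * n)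
    (hca : (n + 1) * c * (1 + a) ^ (2 * d) ≤ 4 ^ n) :
    volume (M.mulVecLin '' zonotope (hilbertGenerators n ε) + flatCube n d (R * √n)) ≤
      ENNReal.ofReal ((4 * R * √n) ^ d * (2 * ε) ^ (n - d)) := by
  have hR : 0 < R := hε.trans_le hεR
  refine (volume_image_add_flatCube_le (isCompact_zonotope _) (convex_zonotope _)
    (by positivity) (V := fun k => √((n + 1) * c) * ε ^ k) (fun k => by positivity)
    (fun k M hM => ?_) hd hM).trans (ENNReal.ofReal_le_ofReal ?_)
  · refine (volume_image_zonotope_hilbertGenerators_le hM hε).trans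
      (ENNReal.ofReal_le_ofReal ?_)
    rw [mul_comm]
    have : ((n + 1).choose k : ℝ) ≤ c := by exact_mod_cast hc k
    gcongr
  · refine (sweepBound_le (by positivity) (fun k => le_rfl) hd).trans ?_
    refine mul_pow_sweep_le hd (Real.sqrt_nonneg _) (by positivity) hε hεR
      (le_mul_two_sqrt ha han) ?_
    rwa [Real.sq_sqrt (by positivity)]

theorem volume_image_hilbertGenerators_add_flatCube_le_of_seven_le (hn : 7 ≤ n)
    (hd : d ≤ n) (hε : 0 < ε) (hεR : ε ≤ R) (hM : M * M.transpose = 1) :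
    volume (M.mulVecLin '' zonotope (hilbertGenerators n ε) + flatCube n d (R * √n)) ≤
      ENNReal.ofReal ((4 * R * √n) ^ d * (2 * ε) ^ (n - d)) := by
  have hn' : (7 : ℝ) ≤ n := by exact_mod_cast hn
  refine volume_image_hilbertGenerators_add_flatCube_le_of_choose_le (by omega) hd hε hεR hM
    (c := 2 ^ n) (a := 0.189) (choose_succ_le_two_pow n) (by norm_num) (by norm_num; linarith) ?_
  have h1 : ((1 : ℝ) + 0.189) ^ (2 * d) ≤ (1.189 ^ 2) ^ n := by
    rw [← pow_mul]
    norm_num only [show (1 : ℝ) + 0.189 = 1.189 by norm_num]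
    exact pow_le_pow_right₀ (by norm_num) (by omega)
  have h2 : ((n : ℝ) + 1) * (1.189 ^ 2) ^ n ≤ 2 ^ n := by
    apply le_of_sq_le_sq _ (by positivity)
    calc (((n : ℝ) + 1) * (1.189 ^ 2) ^ n) ^ 2 = (n + 1) ^ 2 * (1.189 ^ 4) ^ n := by
          rw [mul_pow, ← pow_mul, ← pow_mul, ← pow_mul]
          ring_nf
      _ ≤ 2 ^ n * 2 ^ n := by
          gcongr
          · exact_mod_cast succ_sq_le_two_pow (by omega : 6 ≤ n)
          · norm_num
      _ = _ := by ring
  calc ((n : ℝ) + 1) * (2 ^ n : ℕ) * (1 + 0.189) ^ (2 * d)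
      ≤ (n + 1) * (2 ^ n : ℕ) * (1.189 ^ 2) ^ n := by gcongr
    _ = ((n + 1) * (1.189 ^ 2) ^ n) * 2 ^ n := by push_cast; ring
    _ ≤ 2 ^ n * 2 ^ n := by gcongr
    _ = 4 ^ n := by rw [← mul_pow]; norm_num

theorem volume_image_hilbertGenerators_add_flatCube_self_le (hε : 0 < ε) (hεR : ε ≤ R)
    (hM : M * M.transpose = 1) :
    volume (M.mulVecLin '' zonotope (hilbertGenerators n ε) + flatCube n n (R * √n)) ≤
      ENNReal.ofReal ((4 * R * √n) ^ n) := by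
  have hR : 0 < R := hε.trans_le hεR
  have hsub : M.mulVecLin '' zonotope (hilbertGenerators n ε) + flatCube n n (R * √n) ⊆
      Set.Icc (fun _ => -(2 * R * √n)) (fun _ => 2 * R * √n) := by
    rintro _ ⟨_, ⟨y, hy, rfl⟩, z, hz, rfl⟩
    rw [← Set.pi_univ_Icc, Set.mem_univ_pi]
    intro i
    have h1 := abs_mulVec_le hM hε.le (abs_le_of_mem_zonotope_hilbertGenerators hε hy) i
    have h2 := (mem_flatCube.1 hz i).1 i.2
    have h3 : √n * ε ≤ R * √n := by
      rw [mul_comm R]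
      gcongr
    exact abs_le.1 (by linarith [abs_add_le (M.mulVec y i) (z i)] :
      |M.mulVec y i + z i| ≤ 2 * R * √n)
  refine (measure_mono hsub).trans ?_
  rw [Real.volume_Icc_pi, Finset.prod_const, Finset.card_univ, Fintype.card_fin,
    ← ENNReal.ofReal_pow (by linarith [show 0 ≤ 2 * R * √n by positivity])]
  apply le_of_eq
  ring_nf

end

theorem volume_image_hilbertGenerators_two_add_flatCube_one_le {R ε : ℝ} (hε : 0 < ε)
    (hεR : ε ≤ R) {M : Matrix (Fin 2) (Fin 2) ℝ} (hM : M * M.transpose = 1) :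
    volume (M.mulVecLin '' zonotope (hilbertGenerators 2 ε) + flatCube 2 1 (R * √2)) ≤
      ENNReal.ofReal (4 * R * √2 * (2 * ε)) := by
  have hR : 0 < R := hε.trans_le hεR
  have h2 : √2 ^ 2 = (2 : ℝ) := Real.sq_sqrt (by norm_num)
  have h2' : (1.4 : ℝ) ≤ √2 := Real.le_sqrt_of_sq_le (by norm_num)
  refine (volume_image_add_flatCube_le (isCompact_zonotope _) (convex_zonotope _)
    (by positivity)
    (V := fun k => if k = 1 then 2 * √2 * ε else ε ^ k * √((2 + 1) * (2 + 1).choose k))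
    (fun k => by positivity) (fun k M hM => ?_) one_le_two hM).trans (ENNReal.ofReal_le_ofReal ?_)
  · split_ifs with hk
    · subst hk
      have hsub : M.mulVecLin '' zonotope (hilbertGenerators 2 ε) ⊆
          Set.Icc (fun _ => -(√2 * ε)) (fun _ => √2 * ε) := by
        rintro _ ⟨y, hy, rfl⟩
        rw [← Set.pi_univ_Icc, Set.mem_univ_pi]
        intro i
        have h1 := abs_mulVec_le hM hε.le (abs_le_of_mem_zonotope_hilbertGenerators hε hy) i
        exact abs_le.1 h1
      refine (measure_mono hsub).trans ?_
      rw [Real.volume_Icc_pi, Fin.prod_univ_one]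
      exact ENNReal.ofReal_le_ofReal (by linarith)
    · exact_mod_cast volume_image_zonotope_hilbertGenerators_le hM hε
  · have h9 : √(9 : ℝ) = 3 := by rw [show (9 : ℝ) = 3 ^ 2 by norm_num]; simp
    norm_num [sweepBound, Nat.choose, h9]
    nlinarith [mul_pos hR hε, mul_le_mul_of_nonneg_left hεR hε.le,
      mul_le_mul_of_nonneg_left h2' (mul_pos hR hε).le]

theorem volume_image_hilbertGenerators_three_add_flatCube_two_le {R ε : ℝ} (hε : 0 < ε)
    (hεR : ε ≤ R) {M : Matrix (Fin 3) (Fin 3) ℝ} (hM : M * M.transpose = 1) :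
    volume (M.mulVecLin '' zonotope (hilbertGenerators 3 ε) + flatCube 3 2 (R * √3)) ≤
      ENNReal.ofReal ((4 * R * √3) ^ 2 * (2 * ε)) := by
  have hR : 0 < R := hε.trans_le hεR
  have h3 : √3 ^ 2 = (3 : ℝ) := Real.sq_sqrt (by norm_num)
  have h3' : √3 ≤ (1.75 : ℝ) := Real.sqrt_le_iff.2 (by norm_num)
  refine (volume_image_add_flatCube_le (isCompact_zonotope _) (convex_zonotope _)
    (by positivity) (V := fun k => ε ^ k * √((3 + 1) * (3 + 1).choose k))
    (fun k => by positivity)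
    (fun k M hM => by exact_mod_cast volume_image_zonotope_hilbertGenerators_le hM hε)
    (by norm_num) hM).trans (ENNReal.ofReal_le_ofReal ?_)
  have h16 : √(16 : ℝ) = 4 := by rw [show (16 : ℝ) = 4 ^ 2 by norm_num]; simp
  have h24 : √(24 : ℝ) ≤ 5 := Real.sqrt_le_iff.2 (by norm_num)
  norm_num [sweepBound, Nat.choose, h16]
  have e1 : ε ^ 3 ≤ R ^ 2 * ε := by
    rw [pow_succ]
    gcongr
  have e2 : R * √3 * (ε ^ 2 * √24) ≤ R ^ 2 * ε * (1.75 * 5) := by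
    calc R * √3 * (ε ^ 2 * √24) ≤ R * 1.75 * ((ε * R) * 5) := by
          rw [sq]
          gcongr
      _ = _ := by ring
  have e3 : (R * √3) * (R * √3) * ε = 3 * (R ^ 2 * ε) := by linear_combination R ^ 2 * ε * h3
  have e4 : (4 * R * √3) ^ 2 * (2 * ε) = 96 * (R ^ 2 * ε) := by
    linear_combination 32 * R ^ 2 * ε * h3
  have e5 : 0 < R ^ 2 * ε := by positivity
  rw [e4]
  nlinarith

/-- Volume of an orthogonal image of the Hilbert ball plus a flat cube. -/
theorem volume_image_hilbertGenerators_add_flatCube_le {n d : ℕ} (hn : 0 < n) (hd : d ≤ n)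
    {R ε : ℝ} (hε : 0 < ε) (hεR : ε ≤ R) {M : Matrix (Fin n) (Fin n) ℝ}
    (hM : M * M.transpose = 1) :
    volume (M.mulVecLin '' zonotope (hilbertGenerators n ε) + flatCube n d (R * √n)) ≤
      ENNReal.ofReal ((4 * R * √n) ^ d * (2 * ε) ^ (n - d)) := by
  rcases le_or_gt 7 n with h7 | h7
  · exact volume_image_hilbertGenerators_add_flatCube_le_of_seven_le h7 hd hε hεR hM
  rcases hd.eq_or_lt with rfl | hlt
  · simpa using volume_image_hilbertGenerators_add_flatCube_self_le hε hεR hM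
  have middle : ∀ {c : ℕ} {a : ℝ}, (n + 1).choose ((n + 1) / 2) ≤ c → 0 < a →
      1 ≤ 4 * a ^ 2 * n → (n + 1) * c * (1 + a) ^ (2 * d) ≤ 4 ^ n →
      volume (M.mulVecLin '' zonotope (hilbertGenerators n ε) + flatCube n d (R * √n)) ≤
        ENNReal.ofReal ((4 * R * √n) ^ d * (2 * ε) ^ (n - d)) := fun hc ha han hca =>
    volume_image_hilbertGenerators_add_flatCube_le_of_choose_le hn hd hε hεR hM
      (fun k => (Nat.choose_le_middle k (n + 1)).trans hc) ha han hca
  interval_cases n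
  · refine middle (c := 2) (a := 1) (by decide) (by norm_num) (by norm_num) ?_
    interval_cases d; norm_num
  · interval_cases d
    · exact middle (c := 3) (a := 1) (by decide) (by norm_num) (by norm_num) (by norm_num)
    · simpa using volume_image_hilbertGenerators_two_add_flatCube_one_le hε hεR hM
  · interval_cases d
    · exact middle (c := 6) (a := 0.29) (by decide) (by norm_num) (by norm_num) (by norm_num)
    · exact middle (c := 6) (a := 0.29) (by decide) (by norm_num) (by norm_num) (by norm_num)
    · simpa using volume_image_hilbertGenerators_three_add_flatCube_two_le hε hεR hM
  · refine middle (c := 10) (a := 0.25) (by decide) (by norm_num) (by norm_num) ?_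
    interval_cases d <;> norm_num
  · refine middle (c := 20) (a := 0.224) (by decide) (by norm_num) (by norm_num) ?_
    interval_cases d <;> norm_num
  · refine middle (c := 35) (a := 0.205) (by decide) (by norm_num) (by norm_num) ?_
    interval_cases d <;> norm_num

theorem toMatrix'_mul_transpose_of_sum_sq_eq {n : ℕ} (θ : (Fin n → ℝ) →ₗ[ℝ] (Fin n → ℝ))
    (hθ : ∀ x : Fin n → ℝ, ∑ i, (θ x i) ^ 2 = ∑ i, (x i) ^ 2) :
    θ.toMatrix'.transpose * θ.toMatrix' = 1 := by
  have hdot : ∀ x : Fin n → ℝ, θ x ⬝ᵥ θ x = x ⬝ᵥ x := fun x => by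
    simpa [dotProduct, sq] using hθ x
  have hpol : ∀ x y : Fin n → ℝ, θ x ⬝ᵥ θ y = x ⬝ᵥ y := by
    intro x y
    have h := hdot (x + y)
    rw [map_add, add_dotProduct, add_dotProduct, dotProduct_add, dotProduct_add, dotProduct_add,
      dotProduct_add, hdot, hdot, dotProduct_comm (θ y), dotProduct_comm y x] at h
    linarith
  ext i j
  have h := hpol (Pi.single i 1) (Pi.single j 1)
  rw [single_one_dotProduct] at h
  rw [Matrix.mul_apply]
  simpa [dotProduct, LinearMap.toMatrix'_apply, Matrix.one_apply, Pi.single_apply] using h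

theorem volume_add_hilbertBall_le {n d : ℕ} (hn : 0 < n) (hd : d ≤ n) {R ε : ℝ} (hε : 0 < ε)
    (hεR : ε ≤ R) {K : Set (Fin n → ℝ)} {v : Fin n → ℝ} {θ : (Fin n → ℝ) →ₗ[ℝ] (Fin n → ℝ)}
    (hθ : ∀ x : Fin n → ℝ, ∑ i, (θ x i) ^ 2 = ∑ i, (x i) ^ 2)
    (hK : K ⊆ (fun z => v + θ z) '' flatCube n d (R * √n)) :
    volume (K + hilbertBall n ε) ≤
      ENNReal.ofReal ((4 * R * √n) ^ d * (2 * ε) ^ (n - d)) := by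
  set O := θ.toMatrix' with hO
  have hOO : O.transpose * O = 1 := toMatrix'_mul_transpose_of_sum_sq_eq θ hθ
  have hOO' : O * O.transpose = 1 := mul_eq_one_comm.1 hOO
  have hM : O.transpose * O.transpose.transpose = 1 := by rwa [Matrix.transpose_transpose]
  have happ : ∀ x, θ x = O.mulVec x := fun x => by
    rw [hO, ← Matrix.toLin'_apply, Matrix.toLin'_toMatrix']
  set X := O.transpose.mulVecLin '' zonotope (hilbertGenerators n ε) + flatCube n d (R * √n)
    with hX
  have hsub : K + hilbertBall n ε ⊆ v +ᵥ θ '' X := by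
    rintro _ ⟨x, hx, y, hy, rfl⟩
    obtain ⟨z, hz, rfl⟩ := hK hx
    refine ⟨θ (O.transpose.mulVecLin y + z), ⟨_, Set.add_mem_add
      ⟨y, hilbertBall_subset_zonotope hε hy, rfl⟩ hz, rfl⟩, ?_⟩
    have : θ (O.transpose.mulVec y) = y := by
      rw [happ, Matrix.mulVec_mulVec, hOO', Matrix.one_mulVec]
    simp only [vadd_eq_add, map_add, Matrix.mulVecLin_apply, this]
    abel
  have hdet : |LinearMap.det θ| = 1 := by
    have h := congrArg Matrix.det hOO
    rw [Matrix.det_mul, Matrix.det_transpose, Matrix.det_one, hO, LinearMap.det_toMatrix'] at h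
    rw [← Real.sqrt_sq_eq_abs, sq, h, Real.sqrt_one]
  refine (measure_mono hsub).trans ?_
  rw [measure_vadd, Measure.addHaar_image_linearMap, hdet, ENNReal.ofReal_one, one_mul]
  exact volume_image_hilbertGenerators_add_flatCube_le hn hd hε hεR hM

/-- If `K ⊆ ℝ^(m-1)` is contained in a translate of a Euclidean-isometric image of the
`d`-cube `[−R√(m−1), R√(m−1)]^d × {0}^(m−1−d)`, then the volume of `K + B_H(ε)` is at
most `(4R√(m−1))^d · (2ε)^(m−1−d)`, for `0 < ε ≤ R`. -/
theorem stmt8 (m : ℕ) (hm : 2 ≤ m) (R ε : ℝ) (hR : 0 < R) (hε : 0 < ε) (hεR : ε ≤ R)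
    (d : ℕ) (hd : d ≤ m - 1) (K : Set (Fin (m - 1) → ℝ)) (v : Fin (m - 1) → ℝ)
    (θ : (Fin (m - 1) → ℝ) →ₗ[ℝ] (Fin (m - 1) → ℝ)) (hθbij : Function.Bijective θ)
    (hθ : ∀ x : Fin (m - 1) → ℝ, ∑ i, (θ x i) ^ 2 = ∑ i, (x i) ^ 2)
    (hK : K ⊆ (fun z => v + θ z) ''
      {y : Fin (m - 1) → ℝ | ∀ i : Fin (m - 1),
        ((i : ℕ) < d → |y i| ≤ R * Real.sqrt ((m : ℝ) - 1)) ∧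
        (d ≤ (i : ℕ) → y i = 0)}) :
    volume (K + hilbertBall (m - 1) ε) ≤
      ENNReal.ofReal ((4 * R * Real.sqrt ((m : ℝ) - 1)) ^ d * (2 * ε) ^ (m - 1 - d)) := by
  have hcast : (m : ℝ) - 1 = ((m - 1 : ℕ) : ℝ) := by
    rw [Nat.cast_sub (by omega), Nat.cast_one]
  rw [hcast] at hK ⊢
  refine volume_add_hilbertBall_le (by omega) hd hε hεR hθ (hK.trans (Set.image_mono ?_))
  exact fun y hy => mem_flatCube.2 hy
end
end

section
/- Let A ∈ ℤ^{m×n} with m ≥ 2 and n ≥ 1, let k be the tropical rank of A, and let R := max_{1≤i≤m} ( max_{1≤j≤n}(A_{ij} − A_{1j}) − min_{1≤j≤n}(A_{ij} − A_{1j}) ), assumed to satisfy R ≥ 1. Then for every real ε with 0 < ε ≤ R, the Lebesgue measure of the Minkowski sum tconv(A) + B_H(ε) ⊆ ℝ^{m−1} is at most 2^m · 3^{m+n−2} · (2R√(m−1))^{k−1} · ε^{m−k}. -/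
open MeasureTheory Pointwise

noncomputable section

/-- A square matrix is tropically nonsingular if the minimum over permutations `σ` of
`∑ i, M i (σ i)` is attained by exactly one permutation. -/
def TropNonsingular {k : ℕ} (M : Fin k → Fin k → ℝ) : Prop :=
  ∃! σ : Equiv.Perm (Fin k), ∀ τ : Equiv.Perm (Fin k),
    ∑ i, M i (σ i) ≤ ∑ i, M i (τ i)

/-- The tropical rank of `A`: the largest `k` such that `A` has a tropically
nonsingular `k × k` submatrix. -/
def tropRank (m n : ℕ) (A : Fin m → Fin n → ℝ) : ℕ :=
  sSup {k : ℕ | ∃ r : Fin k → Fin m, ∃ c : Fin k → Fin n,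
    Function.Injective r ∧ Function.Injective c ∧
    TropNonsingular (fun i j => A (r i) (c j))}

/-- The rows at which the column `j` of `A` supports the point `x`. -/
def tightRows {ι κ : Type*} (A : ι → κ → ℝ) (x : ι → ℝ) (j : κ) : Set ι :=
  {i | ∀ i', x i' - A i' j ≤ x i - A i j}

/-- `σ` assigns to each column a row at which it is tight, so that the rows of `S` are hit and
every other row is tight for a column that is assigned to a row of smaller level. -/
structure IsRootedAssignment {ι κ : Type*} (A : ι → κ → ℝ) (x : ι → ℝ) (S : Finset ι)
    (σ : κ → ι) : Prop where
  mem_tightRows : ∀ j, σ j ∈ tightRows A x j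
  hits : ∀ s ∈ S, ∃ j, σ j = s
  descends : ∃ l : ι → ℕ, ∀ i ∉ S, ∃ j, i ∈ tightRows A x j ∧ l (σ j) < l i

theorem SimpleGraph.Reachable.exists_adj_dist_lt {V : Type*} {G : SimpleGraph V} {u w : V}
    (h : G.Reachable u w) (hne : u ≠ w) : ∃ v, G.Adj u v ∧ G.dist v w < G.dist u w := by
  obtain ⟨p, hp⟩ := h.exists_walk_length_eq_dist
  cases p with
  | nil => exact absurd rfl hne
  | @cons _ v _ hadj q =>
    refine ⟨v, hadj, ?_⟩
    rw [← hp, SimpleGraph.Walk.length_cons]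
    exact Nat.lt_succ_of_le (SimpleGraph.dist_le q)

section Assignments

variable {ι κ : Type*} {A : ι → κ → ℝ} {x x' : ι → ℝ}

theorem sub_le_sub_of_mem_tightRows {i i' : ι} {j : κ} (h : i ∈ tightRows A x j)
    (h' : i' ∈ tightRows A x' j) : x i' - x' i' ≤ x i - x' i := by
  linarith [h i', h' i]

/-- A point at which every row is tight for some column has a rooted assignment; its roots
represent the connected components of the graph of tight pairs. -/
theorem exists_isRootedAssignment [Fintype ι] (i₀ : ι)
    (hcov : ∀ i, ∃ j, i ∈ tightRows A x j) :
    ∃ S : Finset ι, i₀ ∈ S ∧ (∃ σ, IsRootedAssignment A x S σ) ∧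
      ∃ c : ι → κ, ∀ s ∈ S, ∀ t ∈ S, s ∈ tightRows A x (c t) ↔ s = t := by
  classical
  let G : SimpleGraph ι :=
    SimpleGraph.fromRel fun i i' => ∃ j, i ∈ tightRows A x j ∧ i' ∈ tightRows A x j
  have hreach : ∀ {i i' j}, i ∈ tightRows A x j → i' ∈ tightRows A x j → G.Reachable i i' := by
    intro i i' j hi hi'
    rcases eq_or_ne i i' with rfl | hne
    · exact SimpleGraph.Reachable.refl _
    · exact SimpleGraph.Adj.reachable
        ((SimpleGraph.fromRel_adj _ _ _).2 ⟨hne, Or.inl ⟨j, hi, hi'⟩⟩)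
  obtain ⟨ρ, hρ, hρeq, hρ₀⟩ : ∃ ρ : ι → ι, (∀ i, G.Reachable i (ρ i)) ∧
      (∀ i i', G.Reachable i i' → ρ i = ρ i') ∧ ρ i₀ = i₀ := by
    let f : G.ConnectedComponent → ι := fun C =>
      if C = G.connectedComponentMk i₀ then i₀ else Quot.out C
    have hf : ∀ C, G.connectedComponentMk (f C) = C := by
      intro C
      rcases eq_or_ne C (G.connectedComponentMk i₀) with rfl | hne
      · simp [f]
      · simp only [f, if_neg hne]
        exact Quot.out_eq C
    refine ⟨fun i => f (G.connectedComponentMk i), fun i => ?_, fun i i' h => ?_, by simp [f]⟩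
    · exact SimpleGraph.ConnectedComponent.exact (hf _).symm
    · exact congrArg f (SimpleGraph.ConnectedComponent.sound h)
  have hne : ∀ j, (tightRows A x j).Nonempty := by
    intro j
    obtain ⟨i, -, hi⟩ := Finset.exists_max_image Finset.univ (fun i => x i - A i j)
      ⟨i₀, Finset.mem_univ _⟩
    exact ⟨i, fun i' => hi i' (Finset.mem_univ _)⟩
  have hmin : ∀ j, ∃ i ∈ tightRows A x j, ∀ i' ∈ tightRows A x j,
      G.dist i (ρ i) ≤ G.dist i' (ρ i') := fun j =>
    Set.exists_min_image _ _ (Set.toFinite _) (hne j)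
  choose σ hσ hσmin using hmin
  choose c hc using hcov
  have hroot : ∀ s ∈ Finset.univ.image ρ, ρ s = s := by
    intro s hs
    obtain ⟨i, -, rfl⟩ := Finset.mem_image.1 hs
    exact (hρeq _ _ (hρ i)).symm
  refine ⟨Finset.univ.image ρ, Finset.mem_image.2 ⟨i₀, Finset.mem_univ _, hρ₀⟩,
    ⟨σ, hσ, fun s hs => ⟨c s, ?_⟩, fun i => G.dist i (ρ i), fun i hi => ?_⟩, c,
    fun s hs t ht => ⟨fun h => ?_, ?_⟩⟩
  · have h0 := hσmin (c s) s (hc s)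
    rw [hroot s hs, SimpleGraph.dist_self, Nat.le_zero, (hρ _).dist_eq_zero_iff] at h0
    rw [h0, hρeq _ _ (hreach (hσ (c s)) (hc s)), hroot s hs]
  · have hne : i ≠ ρ i := fun h => hi (h ▸ Finset.mem_image_of_mem ρ (Finset.mem_univ i))
    obtain ⟨v, hadj, hlt⟩ := (hρ i).exists_adj_dist_lt hne
    replace hlt : G.dist v (ρ v) < G.dist i (ρ i) := by
      rwa [hρeq i v hadj.reachable] at hlt ⊢
    rcases ((SimpleGraph.fromRel_adj _ _ _).1 hadj).2 with ⟨j, h1, h2⟩ | ⟨j, h2, h1⟩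
    · exact ⟨j, h1, (hσmin j v h2).trans_lt hlt⟩
    · exact ⟨j, h1, (hσmin j v h2).trans_lt hlt⟩
  · rw [← hroot s hs, ← hroot t ht]
    exact hρeq _ _ (hreach h (hc t))
  · rintro rfl
    exact hc s

variable [Fintype κ] {S : Finset ι} {σ σ' : κ → ι}

theorem IsRootedAssignment.sub_eq_sub (hσ : IsRootedAssignment A x S σ)
    (hσ' : IsRootedAssignment A x' S σ')
    (hcount : Finset.univ.val.map σ = Finset.univ.val.map σ') (j : κ) :
    x (σ' j) - x' (σ' j) = x (σ j) - x' (σ j) := by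
  have hsum : ∑ j, (x (σ' j) - x' (σ' j)) = ∑ j, (x (σ j) - x' (σ j)) := by
    have := congrArg (fun s => (s.map fun i => x i - x' i).sum) hcount
    simp only [Multiset.map_map] at this
    exact this.symm
  exact (Finset.sum_eq_sum_iff_of_le fun j _ => sub_le_sub_of_mem_tightRows
    (hσ.mem_tightRows j) (hσ'.mem_tightRows j)).1 hsum j (Finset.mem_univ j)

theorem IsRootedAssignment.le_sub (hσ : IsRootedAssignment A x S σ)
    (hσ' : IsRootedAssignment A x' S σ')
    (hcount : Finset.univ.val.map σ = Finset.univ.val.map σ') {b : ℝ}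
    (hb : ∀ s ∈ S, b ≤ x s - x' s) (i : ι) : b ≤ x i - x' i := by
  obtain ⟨l, hl⟩ := hσ.descends
  induction h : l i using Nat.strong_induction_on generalizing i with
  | _ r ih =>
    by_cases hi : i ∈ S
    · exact hb i hi
    · obtain ⟨j, hij, hlt⟩ := hl i hi
      have h1 := ih _ (h ▸ hlt) (σ j) rfl
      have h2 := sub_le_sub_of_mem_tightRows hij (hσ'.mem_tightRows j)
      rw [hσ.sub_eq_sub hσ' hcount j] at h2
      exact h1.trans h2

theorem IsRootedAssignment.abs_sub_le (hσ : IsRootedAssignment A x S σ)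
    (hσ' : IsRootedAssignment A x' S σ')
    (hcount : Finset.univ.val.map σ = Finset.univ.val.map σ') {b : ℝ}
    (hb : ∀ s ∈ S, |x s - x' s| ≤ b) (i : ι) : |x i - x' i| ≤ b := by
  refine abs_le.2 ⟨hσ.le_sub hσ' hcount (fun s hs => (abs_le.1 (hb s hs)).1) i, ?_⟩
  have := hσ'.le_sub hσ hcount.symm (b := -b)
    (fun s hs => by linarith [(abs_le.1 (hb s hs)).2]) i
  linarith

theorem IsRootedAssignment.val_le_map (hσ : IsRootedAssignment A x S σ) :
    S.val ≤ Finset.univ.val.map σ := by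
  rw [Multiset.le_iff_subset S.nodup]
  intro s hs
  obtain ⟨j, rfl⟩ := hσ.hits s hs
  exact Multiset.mem_map_of_mem σ (Finset.mem_univ j)

end Assignments

theorem mem_upperBounds_tropRank_set (m n : ℕ) (A : Fin m → Fin n → ℝ) :
    m ∈ upperBounds {k : ℕ | ∃ r : Fin k → Fin m, ∃ c : Fin k → Fin n,
      Function.Injective r ∧ Function.Injective c ∧
      TropNonsingular (fun i j => A (r i) (c j))} := by
  rintro k ⟨r, c, hr, -, -⟩
  simpa using Fintype.card_le_of_injective r hr

theorem tropRank_le (m n : ℕ) (A : Fin m → Fin n → ℝ) : tropRank m n A ≤ m :=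
  csSup_le' (mem_upperBounds_tropRank_set m n A)

theorem card_le_tropRank {m n : ℕ} {A : Fin m → Fin n → ℝ} {x : Fin m → ℝ}
    {S : Finset (Fin m)} {c : Fin m → Fin n}
    (hc : ∀ s ∈ S, ∀ t ∈ S, s ∈ tightRows A x (c t) ↔ s = t) : S.card ≤ tropRank m n A := by
  refine le_csSup ⟨m, mem_upperBounds_tropRank_set m n A⟩ ?_
  let r : Fin S.card → Fin m := fun a => S.equivFin.symm a
  have hrS : ∀ a, r a ∈ S := fun a => (S.equivFin.symm a).2
  have hr : Function.Injective r := Subtype.val_injective.comp S.equivFin.symm.injective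
  have hle : ∀ a b, x (r a) - (x (r b) - A (r b) (c (r b))) ≤ A (r a) (c (r b)) := by
    intro a b
    linarith [(hc (r b) (hrS b) (r b) (hrS b)).2 rfl (r a)]
  have hlt : ∀ a b, a ≠ b →
      x (r a) - (x (r b) - A (r b) (c (r b))) < A (r a) (c (r b)) := by
    intro a b hab
    refine (hle a b).lt_of_ne fun h => hab (hr ((hc _ (hrS a) _ (hrS b)).1 fun i => ?_))
    linarith [(hc (r b) (hrS b) (r b) (hrS b)).2 rfl i]
  have hsum : ∀ τ : Equiv.Perm (Fin S.card),
      ∑ a, (x (r a) - (x (r (τ a)) - A (r (τ a)) (c (r (τ a))))) =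
        ∑ a, A (r a) (c (r a)) := by
    intro τ
    have h1 := Equiv.sum_comp τ fun a => x (r a)
    have h2 := Equiv.sum_comp τ fun a => A (r a) (c (r a))
    simp only [Finset.sum_sub_distrib]
    linarith
  refine ⟨r, fun a => c (r a), hr, fun a b hab => ?_, 1, fun τ => ?_, fun τ hτ => ?_⟩
  · refine hr ((hc _ (hrS a) _ (hrS b)).1 ?_)
    have := (hc _ (hrS a) _ (hrS a)).2 rfl
    simpa only [hab] using this
  · simp only [Equiv.Perm.coe_one, id]
    rw [← hsum τ]
    exact Finset.sum_le_sum fun a _ => hle a (τ a)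
  · by_contra hne
    obtain ⟨a, ha⟩ : ∃ a, τ a ≠ a := by
      by_contra! h
      exact hne (Equiv.ext h)
    have h1 := hτ 1
    simp only [Equiv.Perm.coe_one, id] at h1
    rw [← hsum τ] at h1
    exact absurd (Finset.sum_lt_sum (fun a _ => hle a (τ a))
      ⟨a, Finset.mem_univ a, hlt a (τ a) ha.symm⟩) h1.not_gt

/-- Every row is tight for some column at a point of `tconv`. -/
theorem exists_mem_tightRows_of_mem_tconv {M n : ℕ} (hn : 1 ≤ n)
    {A : Fin (M + 1) → Fin n → ℝ} {y : Fin M → ℝ} (hy : y ∈ tconv (M + 1) A)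
    (i : Fin (M + 1)) : ∃ j, i ∈ tightRows A (Fin.cons 0 y : Fin (M + 1) → ℝ) j := by
  obtain ⟨α, hα⟩ := hy
  have : Nonempty (Fin n) := ⟨⟨0, hn⟩⟩
  have hx : ∀ i, (Fin.cons 0 y : Fin (M + 1) → ℝ) i =
      (⨅ j, (α j + A i j)) - ⨅ j, (α j + A 0 j) := by
    intro i
    refine Fin.cases ?_ (fun k => ?_) i
    · simp
    · rw [Fin.cons_succ]
      exact hα k
  obtain ⟨j, hj⟩ := exists_eq_ciInf_of_finite (f := fun j => α j + A i j)
  refine ⟨j, fun i' => ?_⟩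
  have h1 : (⨅ j, (α j + A i' j)) ≤ α j + A i' j := ciInf_le (Set.finite_range _).bddBelow j
  rw [hx, hx, ← hj]
  linarith

theorem apply_mem_Icc_of_mem_tconv {M n : ℕ} (hn : 1 ≤ n)
    {A : Fin (M + 1) → Fin n → ℝ} {y : Fin M → ℝ} (hy : y ∈ tconv (M + 1) A) (i : Fin M) :
    y i ∈ Set.Icc (⨅ j, (A i.succ j - A 0 j)) (⨆ j, (A i.succ j - A 0 j)) := by
  obtain ⟨j, hj⟩ := exists_mem_tightRows_of_mem_tconv hn hy i.succ
  obtain ⟨j', hj'⟩ := exists_mem_tightRows_of_mem_tconv hn hy 0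
  have h1 := hj 0
  have h2 := hj' i.succ
  simp only [Fin.cons_zero, Fin.cons_succ] at h1 h2
  constructor
  · refine (ciInf_le (Set.finite_range _).bddBelow j).trans ?_
    linarith
  · refine le_trans ?_ (le_ciSup (Set.finite_range _).bddAbove j')
    linarith

theorem abs_apply_le_of_mem_hilbertBall {M : ℕ} {δ : ℝ} {y : Fin M → ℝ}
    (hy : y ∈ hilbertBall M δ) (i : Fin M) : |y i| ≤ δ := by
  have h : max 0 (⨆ i, y i) - min 0 (⨅ i, y i) ≤ δ := hy
  have h1 := le_ciSup (Set.finite_range y).bddAbove i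
  have h2 := ciInf_le (Set.finite_range y).bddBelow i
  have h3 := le_max_left 0 (⨆ i, y i)
  have h4 := le_max_right 0 (⨆ i, y i)
  have h5 := min_le_left 0 (⨅ i, y i)
  have h6 := min_le_right 0 (⨅ i, y i)
  exact abs_le.2 ⟨by linarith, by linarith⟩

theorem volume_add_hilbertBall_le_s9 {M : ℕ} {P : Set (Fin M → ℝ)} {δ ε : ℝ}
    (hP : ∀ y ∈ P, ∀ y' ∈ P, ∀ i, |y i - y' i| ≤ δ) :
    volume (P + hilbertBall M ε) ≤ ENNReal.ofReal (δ + 2 * ε) ^ M := by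
  refine (Real.volume_pi_le_diam_pow _).trans ?_
  rw [Fintype.card_fin]
  gcongr
  refine Metric.ediam_le ?_
  rintro _ ⟨y, hy, b, hb, rfl⟩ _ ⟨y', hy', b', hb', rfl⟩
  refine edist_pi_le_iff.2 fun i => ?_
  rw [edist_dist, Real.dist_eq]
  refine ENNReal.ofReal_le_ofReal ?_
  have h1 := abs_le.1 (hP y hy y' hy' i)
  have h2 := abs_le.1 (abs_apply_le_of_mem_hilbertBall hb i)
  have h3 := abs_le.1 (abs_apply_le_of_mem_hilbertBall hb' i)
  simp only [Pi.add_apply]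
  exact abs_le.2 ⟨by linarith, by linarith⟩

/-- The rows indexed by `S`, shifted by one, together with the first row. -/
def withZero {M : ℕ} (S : Finset (Fin M)) : Finset (Fin (M + 1)) :=
  Finset.cons 0 (S.map (Fin.succEmb M)) (by simp [Fin.succ_ne_zero])

theorem card_withZero {M : ℕ} (S : Finset (Fin M)) : (withZero S).card = S.card + 1 := by
  simp [withZero]

theorem exists_withZero_eq {M : ℕ} {T : Finset (Fin (M + 1))} (h : 0 ∈ T) :
    ∃ S, withZero S = T := by
  classical
  refine ⟨Finset.univ.filter fun i => i.succ ∈ T, ?_⟩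
  ext i
  refine Fin.cases ?_ (fun k => ?_) i
  · simp [withZero, h]
  · simp [withZero, Fin.succ_ne_zero]

/-- The points of `tconv` having a rooted assignment with roots `S` and the given excess
multiset `p`, and lying in a given cell of the grid of mesh `ε` on the coordinates in `S`. -/
def tconvPiece {M n : ℕ} (A : Fin (M + 1) → Fin n → ℝ) (ε : ℝ) (L : ℕ) (S : Finset (Fin M))
    (p : Sym (Fin (M + 1)) (n - 1 - S.card)) (γ : S → Fin L) : Set (Fin M → ℝ) :=
  {y | (∃ σ, IsRootedAssignment A (Fin.cons 0 y) (withZero S) σ ∧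
      Finset.univ.val.map σ = p.1 + (withZero S).val) ∧
    ∀ s : S, ε * γ s ≤ y s - (⨅ j, (A s.1.succ j - A 0 j)) ∧
      y s - (⨅ j, (A s.1.succ j - A 0 j)) ≤ ε * γ s + ε}

theorem abs_sub_le_of_mem_tconvPiece {M n : ℕ} {A : Fin (M + 1) → Fin n → ℝ} {ε : ℝ}
    (hε : 0 ≤ ε) {L : ℕ} {S : Finset (Fin M)} {p : Sym (Fin (M + 1)) (n - 1 - S.card)}
    {γ : S → Fin L} {y y' : Fin M → ℝ} (hy : y ∈ tconvPiece A ε L S p γ)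
    (hy' : y' ∈ tconvPiece A ε L S p γ) (i : Fin M) : |y i - y' i| ≤ ε := by
  obtain ⟨⟨σ, hσ, hcount⟩, hgrid⟩ := hy
  obtain ⟨⟨σ', hσ', hcount'⟩, hgrid'⟩ := hy'
  have := hσ.abs_sub_le hσ' (hcount.trans hcount'.symm) (b := ε) (fun s hs => ?_) i.succ
  · simpa using this
  · simp only [withZero, Finset.mem_cons, Finset.mem_map] at hs
    obtain rfl | ⟨t, ht, rfl⟩ := hs
    · simpa using hε
    · have h1 := hgrid ⟨t, ht⟩
      have h2 := hgrid' ⟨t, ht⟩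
      simp only [Fin.coe_succEmb, Fin.cons_succ]
      exact abs_le.2 ⟨by linarith [h1.1, h2.2], by linarith [h1.2, h2.1]⟩

theorem exists_mem_tconvPiece {M n : ℕ} (hn : 1 ≤ n) {A : Fin (M + 1) → Fin n → ℝ} {R ε : ℝ}
    (hR : ∀ i, (⨆ j, (A i j - A 0 j)) - (⨅ j, (A i j - A 0 j)) ≤ R) (hε : 0 < ε)
    {y : Fin M → ℝ} (hy : y ∈ tconv (M + 1) A) :
    ∃ S : Finset (Fin M), (S.card + 1 ≤ tropRank (M + 1) n A ∧ S.card + 1 ≤ n) ∧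
      ∃ p γ, y ∈ tconvPiece A ε (⌊R / ε⌋₊ + 1) S p γ := by
  obtain ⟨T, h0, ⟨σ, hσ⟩, c, hc⟩ := exists_isRootedAssignment (0 : Fin (M + 1))
    (exists_mem_tightRows_of_mem_tconv hn hy)
  obtain ⟨S, rfl⟩ := exists_withZero_eq h0
  have hle := hσ.val_le_map
  have hcard := Multiset.card_le_card hle
  have hrank := card_le_tropRank hc
  simp only [Finset.card_val, card_withZero, Multiset.card_map, Finset.card_univ,
    Fintype.card_fin] at hcard hrank
  refine ⟨S, ⟨hrank, hcard⟩,
    ⟨Finset.univ.val.map σ - (withZero S).val, ?_⟩,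
    fun s => ⟨⌊(y s - (⨅ j, (A s.1.succ j - A 0 j))) / ε⌋₊, ?_⟩,
    ⟨σ, hσ, (tsub_add_cancel_of_le hle).symm⟩, fun s => ?_⟩
  · rw [Multiset.card_sub hle]
    simp only [Finset.card_val, card_withZero, Multiset.card_map, Finset.card_univ,
      Fintype.card_fin]
    omega
  · refine Nat.lt_succ_of_le (Nat.floor_le_floor ?_)
    gcongr
    linarith [(apply_mem_Icc_of_mem_tconv hn hy s).2, hR s.1.succ]
  · have h1 : 0 ≤ (y s - (⨅ j, (A s.1.succ j - A 0 j))) / ε :=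
      div_nonneg (by linarith [(apply_mem_Icc_of_mem_tconv hn hy s).1]) hε.le
    have h2 := Nat.floor_le h1
    have h3 := (Nat.lt_floor_add_one ((y s - (⨅ j, (A s.1.succ j - A 0 j))) / ε)).le
    rw [le_div_iff₀ hε] at h2
    rw [div_le_iff₀ hε] at h3
    constructor
    · simpa [mul_comm] using h2
    · linarith

theorem two_pow_mul_card_sym_le (M r : ℕ) :
    2 ^ M * Fintype.card (Sym (Fin (M + 1)) r) ≤ 3 ^ (M + r) := by
  rw [Sym.card_sym_eq_choose, Fintype.card_fin, Nat.add_right_comm, Nat.add_sub_cancel,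
    show (3 : ℕ) = 2 + 1 from rfl, add_pow]
  refine le_of_eq_of_le ?_ (Finset.single_le_sum (f := fun k =>
    2 ^ k * 1 ^ (M + r - k) * (M + r).choose k) (fun _ _ => Nat.zero_le _)
    (Finset.mem_range.2 (show M < M + r + 1 by omega)))
  simp only [one_pow, mul_one]
  rw [← Nat.choose_symm_add]

theorem sum_card_pieces_le {M n k L : ℕ} {t : ℝ} (ht : 1 ≤ t) (hL : (L : ℝ) ≤ t) :
    (∑ S : Finset (Fin M) with S.card + 1 ≤ k ∧ S.card + 1 ≤ n,
      (Fintype.card (Sym (Fin (M + 1)) (n - 1 - S.card) × (S → Fin L)) : ℝ)) ≤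
      2 ^ M * 3 ^ (n - 1) * t ^ (k - 1) := by
  have hterm : ∀ S ∈ Finset.univ.filter
      (fun S : Finset (Fin M) => S.card + 1 ≤ k ∧ S.card + 1 ≤ n),
      (Fintype.card (Sym (Fin (M + 1)) (n - 1 - S.card) × (S → Fin L)) : ℝ) ≤
        1 ^ S.card * 3 ^ (M - S.card) * (3 ^ (n - 1) * t ^ (k - 1) / 2 ^ M) := by
    intro S hS
    obtain ⟨hk, hn⟩ := (Finset.mem_filter.1 hS).2
    have hSM : S.card ≤ M := by simpa using S.card_le_univ
    have h1 : (2 : ℝ) ^ M * Fintype.card (Sym (Fin (M + 1)) (n - 1 - S.card)) ≤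
        3 ^ (M + (n - 1 - S.card)) := mod_cast two_pow_mul_card_sym_le M _
    have h2 : (L : ℝ) ^ S.card ≤ t ^ (k - 1) :=
      (pow_le_pow_left₀ (Nat.cast_nonneg L) hL _).trans (pow_le_pow_right₀ ht (by omega))
    rw [show M + (n - 1 - S.card) = (M - S.card) + (n - 1) by omega, pow_add] at h1
    rw [← mul_div_assoc, le_div_iff₀ (by positivity)]
    simp only [Fintype.card_prod, Fintype.card_fun, Fintype.card_fin, Fintype.card_coe,
      Nat.cast_mul, Nat.cast_pow, one_pow, one_mul]
    calc _ = ((2 : ℝ) ^ M * Fintype.card (Sym (Fin (M + 1)) (n - 1 - S.card))) *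
          (L : ℝ) ^ S.card := by ring
      _ ≤ (3 ^ (M - S.card) * 3 ^ (n - 1)) * t ^ (k - 1) := by gcongr
      _ = _ := by ring
  calc _ ≤ ∑ S : Finset (Fin M) with S.card + 1 ≤ k ∧ S.card + 1 ≤ n,
        (1 : ℝ) ^ S.card * 3 ^ (M - S.card) * (3 ^ (n - 1) * t ^ (k - 1) / 2 ^ M) :=
        Finset.sum_le_sum hterm
    _ ≤ ∑ S : Finset (Fin M),
        (1 : ℝ) ^ S.card * 3 ^ (M - S.card) * (3 ^ (n - 1) * t ^ (k - 1) / 2 ^ M) :=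
        Finset.sum_le_sum_of_subset_of_nonneg (Finset.filter_subset _ _)
          fun _ _ _ => by positivity
    _ = 2 ^ M * 3 ^ (n - 1) * t ^ (k - 1) := by
        rw [← Finset.sum_mul, Fin.sum_pow_mul_eq_add_pow,
          show (1 + 3 : ℝ) = 2 * 2 by norm_num, mul_pow]
        field_simp

theorem volume_tconv_add_hilbertBall_le {M n : ℕ} (hn : 1 ≤ n) (A : Fin (M + 1) → Fin n → ℝ)
    {R ε : ℝ} (hR : ∀ i, (⨆ j, (A i j - A 0 j)) - (⨅ j, (A i j - A 0 j)) ≤ R)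
    (hε : 0 < ε) (hεR : ε ≤ R) {T : Set (Fin M → ℝ)} (hT : T ⊆ tconv (M + 1) A) :
    volume (T + hilbertBall M ε) ≤ ENNReal.ofReal
      (2 ^ M * 3 ^ (n - 1) * (2 * R / ε) ^ (tropRank (M + 1) n A - 1) * (3 * ε) ^ M) := by
  classical
  set L := ⌊R / ε⌋₊ + 1 with hL
  set 𝒮 : Finset (Finset (Fin M)) :=
    Finset.univ.filter fun S => S.card + 1 ≤ tropRank (M + 1) n A ∧ S.card + 1 ≤ n
  have hcover : T + hilbertBall M ε ⊆ ⋃ S ∈ 𝒮,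
      ⋃ q : Sym (Fin (M + 1)) (n - 1 - S.card) × (S → Fin L),
        (tconvPiece A ε L S q.1 q.2 + hilbertBall M ε) := by
    rintro _ ⟨y, hy, b, hb, rfl⟩
    obtain ⟨S, hS, p, γ, hp⟩ := exists_mem_tconvPiece hn hR hε (hT hy)
    simp only [Set.mem_iUnion]
    exact ⟨S, Finset.mem_filter.2 ⟨Finset.mem_univ _, hS⟩, (p, γ), y, hp, b, hb, rfl⟩
  have h1 : 1 ≤ R / ε := (one_le_div hε).2 hεR
  have hLt : (L : ℝ) ≤ 2 * R / ε := by
    have := Nat.floor_le (zero_le_one.trans h1)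
    rw [mul_div_assoc, hL]
    push_cast
    linarith
  have ht : 1 ≤ 2 * R / ε := by rw [mul_div_assoc]; linarith
  calc _ ≤ ∑ S ∈ 𝒮, ∑ q : Sym (Fin (M + 1)) (n - 1 - S.card) × (S → Fin L),
        volume (tconvPiece A ε L S q.1 q.2 + hilbertBall M ε) := by
        refine (measure_mono hcover).trans ((measure_biUnion_finset_le _ _).trans ?_)
        exact Finset.sum_le_sum fun S _ => measure_iUnion_fintype_le _ _
    _ ≤ ∑ S ∈ 𝒮, ∑ q : Sym (Fin (M + 1)) (n - 1 - S.card) × (S → Fin L),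
        ENNReal.ofReal (ε + 2 * ε) ^ M := by
        gcongr
        exact volume_add_hilbertBall_le_s9 fun y hy y' hy' =>
          abs_sub_le_of_mem_tconvPiece hε.le hy hy'
    _ = ENNReal.ofReal ((∑ S ∈ 𝒮,
        (Fintype.card (Sym (Fin (M + 1)) (n - 1 - S.card) × (S → Fin L)) : ℝ)) *
          (3 * ε) ^ M) := by
        simp only [Finset.sum_const, Finset.card_univ, nsmul_eq_mul]
        rw [← Finset.sum_mul, ENNReal.ofReal_mul (by positivity),
          ENNReal.ofReal_sum_of_nonneg fun _ _ => Nat.cast_nonneg _,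
          ENNReal.ofReal_pow (by positivity), show ε + 2 * ε = 3 * ε by ring]
        simp only [ENNReal.ofReal_natCast]
    _ ≤ _ := by
        refine ENNReal.ofReal_le_ofReal ?_
        gcongr
        exact sum_card_pieces_le ht hLt

theorem one_le_tropRank {M n : ℕ} (hn : 1 ≤ n) (A : Fin (M + 1) → Fin n → ℝ) :
    1 ≤ tropRank (M + 1) n A := by
  have h0 : (fun k : Fin M => (⨅ j, ((0 : ℝ) + A k.succ j)) - ⨅ j, ((0 : ℝ) + A 0 j)) ∈
      tconv (M + 1) A := ⟨fun _ => 0, fun _ => rfl⟩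
  obtain ⟨S, h, -, c, hc⟩ := exists_isRootedAssignment (0 : Fin (M + 1))
    (exists_mem_tightRows_of_mem_tconv hn h0)
  exact (Finset.card_pos.2 ⟨0, h⟩).trans_le (card_le_tropRank hc)

/-- Upper bound on the volume of the Hilbert outer parallel body of a tropical polytope
with integer generators, in terms of its tropical rank `k`. -/
theorem stmt9 (m n : ℕ) (hm : 2 ≤ m) (hn : 1 ≤ n) (A : Fin m → Fin n → ℤ)
    (k : ℕ) (hk : k = tropRank m n (fun i j => (A i j : ℝ)))
    (R : ℝ)
    (hRdef : R = ⨆ i : Fin m, ((⨆ j, ((A i j : ℝ) - (A ⟨0, by omega⟩ j : ℝ))) -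
        ⨅ j, ((A i j : ℝ) - (A ⟨0, by omega⟩ j : ℝ))))
    (hR1 : 1 ≤ R) (ε : ℝ) (hε : 0 < ε) (hεR : ε ≤ R) :
    volume (tconv m (fun i j => (A i j : ℝ)) + hilbertBall (m - 1) ε) ≤
      ENNReal.ofReal (2 ^ m * 3 ^ (m + n - 2) *
        (2 * R * Real.sqrt ((m : ℝ) - 1)) ^ (k - 1) * ε ^ (m - k)) := by
  obtain ⟨M, rfl⟩ : ∃ M, m = M + 1 := ⟨m - 1, by omega⟩
  have hk1 : 1 ≤ k := hk ▸ one_le_tropRank hn _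
  have hkM : k ≤ M + 1 := hk ▸ tropRank_le _ _ _
  have hR : ∀ i, (⨆ j, ((A i j : ℝ) - (A 0 j : ℝ))) - (⨅ j, ((A i j : ℝ) - (A 0 j : ℝ))) ≤ R := by
    intro i
    rw [hRdef]
    exact le_ciSup (f := fun i : Fin (M + 1) => (⨆ j, ((A i j : ℝ) - (A 0 j : ℝ))) -
      ⨅ j, ((A i j : ℝ) - (A 0 j : ℝ))) (Set.finite_range _).bddAbove i
  refine (volume_tconv_add_hilbertBall_le hn (fun i j => (A i j : ℝ)) hR hε hεR subset_rfl).trans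
    (ENNReal.ofReal_le_ofReal ?_)
  rw [← hk]
  have hsqrt : 1 ≤ Real.sqrt (((M + 1 : ℕ) : ℝ) - 1) := by
    rw [Real.one_le_sqrt]
    have : (1 : ℝ) ≤ M := mod_cast (by omega : 1 ≤ M)
    push_cast
    linarith
  calc (2 : ℝ) ^ M * 3 ^ (n - 1) * (2 * R / ε) ^ (k - 1) * (3 * ε) ^ M
      = 2 ^ M * 3 ^ (M + 1 + n - 2) * (2 * R * 1) ^ (k - 1) * ε ^ (M + 1 - k) := by
        rw [show M + 1 + n - 2 = M + (n - 1) by omega, mul_pow 3 ε M, pow_add 3 M, div_pow, mul_one]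
        rw [show ε ^ M = ε ^ (k - 1) * ε ^ (M + 1 - k) by rw [← pow_add]; congr 1; omega]
        field_simp
    _ ≤ _ := by
        gcongr
        · norm_num
        · omega
end
end
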